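/- arXiv:2109.04415 — 8 statements merged into one kernel-verified Lean document; each statement's English description precedes it below -/
import Mathlib

section
/- There exist absolute constants Γ > 0 and c > 0 such that the following holds. Let k ≥ 2 be an integer and let n, ℓ be integers with 2(k−1) ≤ ℓ ≤ n. Every k-uniform hypergraph on vertex set [n] with at least Γ^k · n · (n/ℓ)^{k/2 − 1} · (log₂ n)^{4k+1} hyperedges contains an even cover of length at most c · ℓ · log₂ n. -/
open Finset

/-- `E` is an even cover in the hypergraph `H` on vertex set `Fin n`: a nonempty
collection of distinct hyperedges of `H` such that every vertex lies in an even
number of them. -/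
def IsEvenCover {n : ℕ} (H E : Finset (Finset (Fin n))) : Prop :=
  E ⊆ H ∧ E.Nonempty ∧ ∀ v : Fin n, Even ((E.filter (fun C => v ∈ C)).card)

section Darts

/-- The reversal of a dart `(S, C, C')`, for a given `next` vertex map. -/
def revDart {V ι : Type*} (next : V × ι × ι → V) (d : V × ι × ι) : V × ι × ι :=
  (next d, d.2.2, d.2.1)

theorem revDart_revDart {V ι : Type*} {D : Finset (V × ι × ι)} {next : V × ι × ι → V}
    (hinv : ∀ d ∈ D, next (revDart next d) = d.1) {d : V × ι × ι} (hd : d ∈ D) :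
    revDart next (revDart next d) = d :=
  Prod.ext (hinv d hd) rfl

variable {V ι A : Type*} [DecidableEq V] [DecidableEq ι] [AddCommGroup A]

/-- One growth step: extend the pairs `(U, S)` by darts at `S` whose labels avoid `U`. -/
def growStep (D : Finset (V × ι × ι)) (next : V × ι × ι → V)
    (X : Finset (Finset ι × V)) : Finset (Finset ι × V) :=
  ((X ×ˢ D).filter fun p => p.2.1 = p.1.2 ∧ p.2.2.1 ∉ p.1.1 ∧ p.2.2.2 ∉ p.1.1).image
    fun p => (insert p.2.2.1 (insert p.2.2.2 p.1.1), next p.2)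

theorem card_growStep {D : Finset (V × ι × ι)} {next : V × ι × ι → V}
    (hrev : ∀ d ∈ D, revDart next d ∈ D) (hinv : ∀ d ∈ D, next (revDart next d) = d.1)
    {Λ : ℕ}
    (hΛ₁ : ∀ S C, #{d ∈ D | d.1 = S ∧ d.2.1 = C} ≤ Λ)
    (hΛ₂ : ∀ S C, #{d ∈ D | d.1 = S ∧ d.2.2 = C} ≤ Λ)
    {δ u : ℕ} {X : Finset (Finset ι × V)}
    (hX : ∀ p ∈ X, #p.1 = u ∧ δ ≤ #{d ∈ D | d.1 = p.2}) :
    #X * (δ - 2 * (u * Λ)) ≤ (u + 2) * Λ * #(growStep D next X) := by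
  classical
  set Y := (X ×ˢ D).filter
    fun p => p.2.1 = p.1.2 ∧ p.2.2.1 ∉ p.1.1 ∧ p.2.2.2 ∉ p.1.1 with hY
  have lower : #X * (δ - 2 * (u * Λ)) ≤ #Y := by
    have h : #Y = ∑ p ∈ X, #{d ∈ D | d.1 = p.2 ∧ d.2.1 ∉ p.1 ∧ d.2.2 ∉ p.1} := by
      rw [hY, card_filter, sum_product]
      exact sum_congr rfl fun p _ => (card_filter _ _).symm
    rw [h, ← smul_eq_mul, ← Finset.sum_const]
    refine sum_le_sum fun p hp => ?_
    obtain ⟨hu, hδ⟩ := hX p hp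
    have hsub : {d ∈ D | d.1 = p.2} ⊆ {d ∈ D | d.1 = p.2 ∧ d.2.1 ∉ p.1 ∧ d.2.2 ∉ p.1} ∪
        (p.1.biUnion (fun C => {d ∈ D | d.1 = p.2 ∧ d.2.1 = C}) ∪
          p.1.biUnion (fun C => {d ∈ D | d.1 = p.2 ∧ d.2.2 = C})) := by
      intro d hd
      simp only [mem_filter, mem_union, mem_biUnion] at hd ⊢
      by_cases h1 : d.2.1 ∈ p.1
      · exact Or.inr (Or.inl ⟨_, h1, hd.1, hd.2, rfl⟩)
      by_cases h2 : d.2.2 ∈ p.1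
      · exact Or.inr (Or.inr ⟨_, h2, hd.1, hd.2, rfl⟩)
      exact Or.inl ⟨hd.1, hd.2, h1, h2⟩
    have h1 := card_biUnion_le_card_mul p.1 _ Λ (fun C _ => hΛ₁ p.2 C)
    have h2 := card_biUnion_le_card_mul p.1 _ Λ (fun C _ => hΛ₂ p.2 C)
    have h3 := (card_le_card hsub).trans (card_union_le _ _)
    have h4 := card_union_le (p.1.biUnion (fun C => {d ∈ D | d.1 = p.2 ∧ d.2.1 = C}))
      (p.1.biUnion (fun C => {d ∈ D | d.1 = p.2 ∧ d.2.2 = C}))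
    rw [hu] at h1 h2
    omega
  refine lower.trans (card_le_mul_card_image Y _ fun q hq => ?_)
  have hcard : #q.1 ≤ u + 2 := by
    obtain ⟨p, hp, rfl⟩ := mem_image.1 hq
    have hp' := (mem_product.1 (mem_filter.1 hp).1).1
    have := (hX _ hp').1
    have h1 := card_insert_le p.2.2.1 (insert p.2.2.2 p.1.1)
    have h2 := card_insert_le p.2.2.2 p.1.1
    dsimp only
    omega
  have hbi := card_biUnion_le_card_mul q.1
    (fun C => {d ∈ D | d.1 = q.2 ∧ d.2.1 = C}) Λ (fun C _ => hΛ₁ q.2 C)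
  refine le_trans ?_ (hbi.trans (Nat.mul_le_mul_right _ hcard))
  refine card_le_card_of_injOn (fun p => revDart next p.2) ?_ ?_
  · intro p hp
    simp only [coe_filter, Set.mem_ofPred_eq, hY, mem_filter, mem_product] at hp
    obtain ⟨⟨⟨_, hD⟩, _⟩, rfl⟩ := hp
    simp only [coe_biUnion, Set.mem_iUnion, mem_coe, mem_filter]
    exact ⟨p.2.2.2, by simp, hrev _ hD, rfl, rfl⟩
  · rintro ⟨⟨U, S⟩, ⟨S₁, C, C'⟩⟩ hp ⟨⟨U₂, S₂⟩, ⟨S₃, C₂, C₂'⟩⟩ hp₂ heq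
    simp only [coe_filter, Set.mem_ofPred_eq, hY, mem_filter, mem_product] at hp hp₂
    obtain ⟨⟨⟨_, hD⟩, rfl, h1, h2⟩, rfl⟩ := hp
    obtain ⟨⟨⟨_, hD₂⟩, rfl, h3, h4⟩, h5⟩ := hp₂
    have e1 := hinv _ hD
    have e2 := hinv _ hD₂
    dsimp only at heq
    rw [heq, e2] at e1
    simp only [revDart, Prod.mk.injEq] at heq h5 e1
    obtain ⟨_, rfl, rfl⟩ := heq
    subst e1
    have hU : U₂ = U := by
      have := h5.1
      ext c
      have hc := Finset.ext_iff.1 this c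
      simp only [mem_insert] at hc
      by_cases hc1 : c = C
      · subst hc1; simp [h1, h3]
      by_cases hc2 : c = C'
      · subst hc2; simp [h2, h4]
      simpa [hc1, hc2] using hc
    subst hU
    rfl

theorem exists_ne_sum_eq_of_minDegree {D : Finset (V × ι × ι)} {next : V × ι × ι → V}
    (hrev : ∀ d ∈ D, revDart next d ∈ D) (hinv : ∀ d ∈ D, next (revDart next d) = d.1)
    (hne : ∀ d ∈ D, d.2.1 ≠ d.2.2) {Λ : ℕ} (hΛ : 0 < Λ)
    (hΛ₁ : ∀ S C, #{d ∈ D | d.1 = S ∧ d.2.1 = C} ≤ Λ)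
    (hΛ₂ : ∀ S C, #{d ∈ D | d.1 = S ∧ d.2.2 = C} ≤ Λ)
    {vec : ι → A} {f : V → A} (hf : ∀ d ∈ D, f (next d) = f d.1 + vec d.2.1 + vec d.2.2)
    {W : Finset V} (hW : W.Nonempty) (hDW : ∀ d ∈ D, d.1 ∈ W) {r : ℕ}
    (hδ : ∀ S ∈ W, 8 * (r * Λ) ≤ #{d ∈ D | d.1 = S}) (hr : #W < 2 ^ r) :
    ∃ U U' : Finset ι, U ≠ U' ∧ #U ≤ 2 * r ∧ #U' ≤ 2 * r ∧
      ∑ C ∈ U, vec C = ∑ C ∈ U', vec C ∧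
      ∀ C ∈ U ∪ U', ∃ d ∈ D, C = d.2.1 := by
  obtain ⟨S₀, hS₀⟩ := hW
  set X : ℕ → Finset (Finset ι × V) := fun i => (growStep D next)^[i] {(∅, S₀)} with hX
  have inv : ∀ i, ∀ p ∈ X i, #p.1 = 2 * i ∧ p.2 ∈ W ∧ f p.2 = f S₀ + ∑ C ∈ p.1, vec C ∧
      ∀ C ∈ p.1, ∃ d ∈ D, C = d.2.1 := by
    intro i
    induction i with
    | zero =>
      intro p hp
      simp only [hX, Function.iterate_zero, id, mem_singleton] at hp
      subst hp
      simp [hS₀]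
    | succ i ih =>
      intro p hp
      simp only [hX, Function.iterate_succ', Function.comp] at hp
      obtain ⟨q, hq, rfl⟩ := mem_image.1 hp
      simp only [mem_filter, mem_product] at hq
      obtain ⟨⟨hqX, hD⟩, h1, h2, h3⟩ := hq
      obtain ⟨i1, i2, i3, i4⟩ := ih _ hqX
      have hn := hne _ hD
      have h4 : q.2.2.1 ∉ insert q.2.2.2 q.1.1 := by simp [hn, h2]
      refine ⟨?_, hDW _ (hrev _ hD), ?_, ?_⟩
      · dsimp only
        rw [card_insert_of_notMem h4, card_insert_of_notMem h3, i1]; ring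
      · dsimp only
        rw [sum_insert h4, sum_insert h3, hf _ hD, h1, i3]; abel
      · intro C hC
        simp only [mem_insert] at hC
        rcases hC with rfl | rfl | hC
        · exact ⟨_, hD, rfl⟩
        · exact ⟨_, hrev _ hD, rfl⟩
        · exact i4 _ hC
  have growth : ∀ i ≤ r, 2 ^ i ≤ #(X i) := by
    intro i
    induction i with
    | zero => intro _; simp [hX]
    | succ i ih =>
      intro hi
      have h := card_growStep hrev hinv hΛ₁ hΛ₂ (δ := 8 * (r * Λ)) (u := 2 * i) (X := X i)
        (fun p hp => ⟨(inv i p hp).1, hδ _ (inv i p hp).2.1⟩)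
      have hX1 : growStep D next (X i) = X (i + 1) := by
        simp only [hX, Function.iterate_succ', Function.comp]
      rw [hX1] at h
      have h1 : i * Λ ≤ r * Λ := Nat.mul_le_mul_right _ (by omega)
      have h2 : 4 * (r * Λ) ≤ 8 * (r * Λ) - 2 * (2 * i * Λ) := by
        rw [mul_assoc 2 i Λ]; omega
      have h3 : (2 * i + 2) * Λ ≤ 2 * (r * Λ) := by
        rw [← mul_assoc]; exact Nat.mul_le_mul_right _ (by omega)
      have h4 := (Nat.mul_le_mul_left #(X i) h2).trans (h.trans (Nat.mul_le_mul_right _ h3))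
      have h5 : 0 < r * Λ := Nat.mul_pos (by omega) hΛ
      have h6 : 2 * #(X i) ≤ #(X (i + 1)) := by
        refine Nat.le_of_mul_le_mul_left (c := 2 * (r * Λ)) ?_ (by omega)
        calc _ = #(X i) * (4 * (r * Λ)) := by ring
          _ ≤ _ := h4
      have := ih (by omega)
      rw [pow_succ]; omega
  obtain ⟨p, hp, q, hq, hpq, h⟩ := exists_ne_map_eq_of_card_lt_of_maps_to
    (hr.trans_le (growth r le_rfl)) (f := Prod.snd) (fun p hp => (inv r p hp).2.1)
  obtain ⟨p1, _, p3, p4⟩ := inv r p hp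
  obtain ⟨q1, _, q3, q4⟩ := inv r q hq
  refine ⟨p.1, q.1, fun h' => hpq (Prod.ext h' h), p1.le, q1.le, ?_, ?_⟩
  · rw [h, q3] at p3
    exact (add_left_cancel p3).symm
  · intro C hC
    rcases mem_union.1 hC with hC | hC
    exacts [p4 _ hC, q4 _ hC]

theorem exists_minDegree_subset {D : Finset (V × ι × ι)} {next : V × ι × ι → V}
    (hrev : ∀ d ∈ D, revDart next d ∈ D) (hinv : ∀ d ∈ D, next (revDart next d) = d.1)
    {W : Finset V} (hW : W.Nonempty) (hDW : ∀ d ∈ D, d.1 ∈ W) {δ : ℕ}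
    (hD : 2 * δ * #W ≤ #D) :
    ∃ W' ⊆ W, W'.Nonempty ∧
      ∀ S ∈ W', δ ≤ #{d ∈ {d ∈ D | d.1 ∈ W' ∧ next d ∈ W'} | d.1 = S} := by
  let F : Finset V → Finset (V × ι × ι) := fun W' => {d ∈ D | d.1 ∈ W' ∧ next d ∈ W'}
  have hcand : ({W' ∈ W.powerset | W'.Nonempty ∧ 2 * δ * #W' ≤ #(F W')}).Nonempty := by
    refine ⟨W, mem_filter.2 ⟨mem_powerset_self _, hW, ?_⟩⟩
    have : F W = D := filter_true_of_mem fun d hd => ⟨hDW _ hd, hDW _ (hrev _ hd)⟩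
    rwa [this]
  obtain ⟨W', hW', hmin⟩ := exists_min_image _ card hcand
  simp only [mem_filter, mem_powerset] at hW' hmin
  obtain ⟨hsub, hne, hcard⟩ := hW'
  refine ⟨W', hsub, hne, fun S hS => ?_⟩
  by_contra! hlt
  change #{d ∈ F W' | d.1 = S} < δ at hlt
  have hin : #{d ∈ F W' | next d = S} ≤ #{d ∈ F W' | d.1 = S} := by
    refine card_le_card_of_injOn (revDart next) ?_ ?_
    · intro d hd
      simp only [F, coe_filter, mem_filter, Set.mem_ofPred_eq] at hd ⊢
      obtain ⟨⟨h1, h2, h3⟩, h4⟩ := hd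
      exact ⟨⟨hrev _ h1, h3, (hinv _ h1).symm ▸ h2⟩, h4⟩
    · intro d hd e he h
      simp only [F, coe_filter, mem_filter, Set.mem_ofPred_eq] at hd he
      rw [← revDart_revDart hinv hd.1.1, h, revDart_revDart hinv he.1.1]
  have hcover : F W' ⊆ F (W'.erase S) ∪
      ({d ∈ F W' | d.1 = S} ∪ {d ∈ F W' | next d = S}) := by
    intro d hd
    simp only [F, mem_union, mem_filter, mem_erase] at hd ⊢
    tauto
  have h1 := (card_le_card hcover).trans (card_union_le _ _)
  have h2 := card_union_le {d ∈ F W' | d.1 = S} {d ∈ F W' | next d = S}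
  have h3 := card_erase_add_one hS
  rw [← h3, mul_add, mul_one] at hcard
  have h4 : 2 * δ * #(W'.erase S) ≤ #(F (W'.erase S)) := by omega
  rcases (W'.erase S).eq_empty_or_nonempty with he | he
  · have hF : F (W'.erase S) = ∅ := by simp [F, he]
    rw [hF, card_empty] at h1
    rw [he, card_empty] at hcard
    omega
  · have := hmin _ ⟨(erase_subset _ _).trans hsub, he, h4⟩
    omega

theorem card_filter_lt_mul_le {α : Type*} (D : Finset α) (g : α → ℕ) {K : ℕ}
    (h : ∑ d ∈ D, g d ≤ K * #D) : 8 * K * #{d ∈ D | 8 * K < g d} ≤ K * #D := by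
  refine le_trans ?_ ((sum_le_sum_of_subset (filter_subset (fun d => 8 * K < g d) D)).trans h)
  rw [mul_comm, ← smul_eq_mul]
  exact card_nsmul_le_sum _ _ _ fun d hd => (mem_filter.1 hd).2.le

/-- The main abstract step: a dense reversible system of darts whose labels have few partners on
average contains two distinct small label sets with the same sum. -/
theorem exists_ne_sum_eq_of_dense {D : Finset (V × ι × ι)} {next : V × ι × ι → V}
    (hrev : ∀ d ∈ D, revDart next d ∈ D) (hinv : ∀ d ∈ D, next (revDart next d) = d.1)
    (hne : ∀ d ∈ D, d.2.1 ≠ d.2.2) {K : ℕ} (hK : 0 < K)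
    (hK₁ : ∑ d ∈ D, #{e ∈ D | e.1 = d.1 ∧ e.2.1 = d.2.1} ≤ K * #D)
    (hK₂ : ∑ d ∈ D, #{e ∈ D | e.1 = d.1 ∧ e.2.2 = d.2.2} ≤ K * #D)
    {vec : ι → A} {f : V → A} (hf : ∀ d ∈ D, f (next d) = f d.1 + vec d.2.1 + vec d.2.2)
    {W : Finset V} (hW : W.Nonempty) (hDW : ∀ d ∈ D, d.1 ∈ W) {r : ℕ}
    (hD : 256 * (r * K) * #W ≤ #D) (hr : #W < 2 ^ r) :
    ∃ U U' : Finset ι, U ≠ U' ∧ #U ≤ 2 * r ∧ #U' ≤ 2 * r ∧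
      ∑ C ∈ U, vec C = ∑ C ∈ U', vec C ∧
      ∀ C ∈ U ∪ U', ∃ d ∈ D, C = d.2.1 := by
  set Λ := 8 * K with hΛ
  let g₁ : V × ι × ι → ℕ := fun d => #{e ∈ D | e.1 = d.1 ∧ e.2.1 = d.2.1}
  let g₂ : V × ι × ι → ℕ := fun d => #{e ∈ D | e.1 = d.1 ∧ e.2.2 = d.2.2}
  let B₁ := {d ∈ D | Λ < g₁ d}
  let B₂ := {d ∈ D | Λ < g₂ d}
  let G := {d ∈ D | (d ∉ B₁ ∧ d ∉ B₂) ∧ revDart next d ∉ B₁ ∧ revDart next d ∉ B₂}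
  have hB : ∀ B : Finset (V × ι × ι), Λ * #B ≤ K * #D → 8 * #B ≤ #D := by
    intro B h
    refine Nat.le_of_mul_le_mul_left (c := K) ?_ hK
    calc K * (8 * #B) = Λ * #B := by rw [hΛ]; ring
      _ ≤ _ := h
  have hB₁ : 8 * #B₁ ≤ #D := hB _ (card_filter_lt_mul_le D g₁ hK₁)
  have hB₂ : 8 * #B₂ ≤ #D := hB _ (card_filter_lt_mul_le D g₂ hK₂)
  have hrevB : ∀ B ⊆ D, #{d ∈ D | revDart next d ∈ B} ≤ #B := by
    intro B _
    refine card_le_card_of_injOn (revDart next) ?_ ?_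
    · intro d hd
      exact (mem_filter.1 hd).2
    · intro d hd e he h
      rw [← revDart_revDart hinv (mem_filter.1 hd).1, h,
        revDart_revDart hinv (mem_filter.1 he).1]
  have hGD : #D ≤ 2 * #G := by
    have hcover : D ⊆ G ∪ ((B₁ ∪ B₂) ∪
        ({d ∈ D | revDart next d ∈ B₁} ∪ {d ∈ D | revDart next d ∈ B₂})) := by
      intro d hd
      simp only [G, mem_union, mem_filter, hd, true_and]
      tauto
    have h1 := (card_le_card hcover).trans (card_union_le _ _)
    have h2 := card_union_le (B₁ ∪ B₂)
      ({d ∈ D | revDart next d ∈ B₁} ∪ {d ∈ D | revDart next d ∈ B₂})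
    have h3 := card_union_le B₁ B₂
    have h4 := card_union_le {d ∈ D | revDart next d ∈ B₁} {d ∈ D | revDart next d ∈ B₂}
    have h5 := hrevB B₁ (filter_subset _ _)
    have h6 := hrevB B₂ (filter_subset _ _)
    omega
  have hGsub : G ⊆ D := filter_subset _ _
  have hGrev : ∀ d ∈ G, revDart next d ∈ G := by
    intro d hd
    have hd' := mem_filter.1 hd
    refine mem_filter.2 ⟨hrev _ hd'.1, hd'.2.2, ?_⟩
    rw [revDart_revDart hinv hd'.1]
    exact hd'.2.1
  obtain ⟨W', hW'W, hW', hmin⟩ := exists_minDegree_subset hGrev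
    (fun d hd => hinv d (hGsub hd)) hW (fun d hd => hDW d (hGsub hd)) (δ := 8 * (r * Λ)) (by
      have : 256 * (r * K) * #W = 2 * (2 * (8 * (r * Λ)) * #W) := by rw [hΛ]; ring
      omega)
  set D' := {d ∈ G | d.1 ∈ W' ∧ next d ∈ W'} with hD'
  have hD'sub : D' ⊆ G := filter_subset _ _
  have hD'D : D' ⊆ D := hD'sub.trans hGsub
  obtain ⟨U, U', h1, h2, h3, h4, h5⟩ := exists_ne_sum_eq_of_minDegree (D := D') (next := next)
    (Λ := Λ) (r := r) (f := f) (vec := vec)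
    (fun d hd => by
      have hd' := mem_filter.1 hd
      refine mem_filter.2 ⟨hGrev _ hd'.1, hd'.2.2, ?_⟩
      rw [hinv d (hGsub hd'.1)]
      exact hd'.2.1)
    (fun d hd => hinv d (hD'D hd)) (fun d hd => hne d (hD'D hd)) (by positivity)
    (by
      intro S C
      rcases ({d ∈ D' | d.1 = S ∧ d.2.1 = C}).eq_empty_or_nonempty with h | ⟨d, hd⟩
      · simp [h]
      obtain ⟨hd', rfl, rfl⟩ := mem_filter.1 hd
      refine (card_le_card (filter_subset_filter _ hD'D)).trans ?_
      have := (mem_filter.1 (hD'sub hd')).2.1.1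
      simpa [B₁, g₁, hD'D hd'] using this)
    (by
      intro S C
      rcases ({d ∈ D' | d.1 = S ∧ d.2.2 = C}).eq_empty_or_nonempty with h | ⟨d, hd⟩
      · simp [h]
      obtain ⟨hd', rfl, rfl⟩ := mem_filter.1 hd
      refine (card_le_card (filter_subset_filter _ hD'D)).trans ?_
      have := (mem_filter.1 (hD'sub hd')).2.1.2
      simpa [B₂, g₂, hD'D hd'] using this)
    (fun d hd => hf d (hD'D hd)) hW' (fun d hd => (mem_filter.1 hd).2.1) hmin
    ((card_le_card hW'W).trans_lt hr)
  exact ⟨U, U', h1, h2, h3, h4, fun C hC => (h5 C hC).imp fun d hd => ⟨hD'D hd.1, hd.2⟩⟩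

end Darts

section Slices

variable {n : ℕ}

/-- The `x`-element subsets of `Fin n` that meet `A` in exactly `a` elements. -/
def interSlice (A : Finset (Fin n)) (x a : ℕ) : Finset (Finset (Fin n)) :=
  {S ∈ powersetCard x univ | #(S ∩ A) = a}

theorem mem_interSlice {A S : Finset (Fin n)} {x a : ℕ} :
    S ∈ interSlice A x a ↔ #S = x ∧ #(S ∩ A) = a := by
  simp [interSlice, mem_powersetCard]

theorem le_card_interSlice {A : Finset (Fin n)} {x a : ℕ} (hx : a ≤ x) :
    (#A).choose a * (n - #A).choose (x - a) ≤ #(interSlice A x a) := by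
  have : (#A).choose a * (n - #A).choose (x - a) =
      #(powersetCard a A ×ˢ powersetCard (x - a) Aᶜ) := by
    rw [card_product, card_powersetCard, card_powersetCard, card_compl, Fintype.card_fin]
  rw [this]
  have key : ∀ p ∈ powersetCard a A ×ˢ powersetCard (x - a) Aᶜ,
      Disjoint p.1 p.2 ∧ (p.1 ∪ p.2) ∩ A = p.1 ∧ (p.1 ∪ p.2) \ A = p.2 := by
    intro p hp
    simp only [mem_product, mem_powersetCard] at hp
    obtain ⟨⟨h1, h2⟩, h3, h4⟩ := hp
    have h1' := fun v => @h1 v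
    have h3' := fun v => @h3 v
    simp only [mem_compl] at h3'
    refine ⟨disjoint_left.2 fun v hv hv' => h3' v hv' (h1' v hv), ?_, ?_⟩
    · ext v; have := h1' v; have := h3' v; simp only [mem_inter, mem_union]; tauto
    · ext v; have := h1' v; have := h3' v; simp only [mem_sdiff, mem_union]; tauto
  refine card_le_card_of_injOn (fun p => p.1 ∪ p.2) ?_ ?_
  · intro p hp
    obtain ⟨h1, h2, h3⟩ := key p hp
    simp only [mem_coe, mem_product, mem_powersetCard] at hp
    refine mem_interSlice.2 ⟨?_, by rw [h2]; exact hp.1.2⟩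
    rw [card_union_of_disjoint h1]; omega
  · intro p hp p' hp' h
    obtain ⟨_, h2, h3⟩ := key p hp
    obtain ⟨_, h2', h3'⟩ := key p' hp'
    dsimp only at h
    refine Prod.ext ?_ ?_
    · rw [← h2, h, h2']
    · rw [← h3, h, h3']

theorem card_interSlice_superset_le {A I : Finset (Fin n)} (hAI : Disjoint I A) {x a : ℕ} :
    #{S ∈ interSlice A x a | I ⊆ S} ≤ (#A).choose a * (n - #A - #I).choose (x - a - #I) := by
  have : (#A).choose a * (n - #A - #I).choose (x - a - #I) =
      #(powersetCard a A ×ˢ powersetCard (x - a - #I) (A ∪ I)ᶜ) := by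
    rw [card_product, card_powersetCard, card_powersetCard, card_compl, Fintype.card_fin,
      card_union_of_disjoint hAI.symm, Nat.sub_sub]
  rw [this]
  refine card_le_card_of_injOn (fun S => (S ∩ A, S \ (A ∪ I))) ?_ ?_
  · intro S hS
    simp only [coe_filter, Set.mem_ofPred_eq, mem_interSlice] at hS
    obtain ⟨⟨h1, h2⟩, h3⟩ := hS
    simp only [mem_coe, mem_product, mem_powersetCard]
    refine ⟨⟨inter_subset_right, h2⟩, fun v hv => ?_, ?_⟩
    · simp only [mem_sdiff] at hv
      simpa using hv.2
    · have h4 : S \ (A ∪ I) = S \ ((S ∩ A) ∪ I) := by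
        ext v; simp only [mem_sdiff, mem_union, mem_inter]; tauto
      have h5 : Disjoint (S ∩ A) I := (hAI.mono_right inter_subset_right).symm
      rw [h4, card_sdiff_of_subset (union_subset inter_subset_left h3),
        card_union_of_disjoint h5]
      omega
  · intro S hS S' hS' h
    simp only [coe_filter, Set.mem_ofPred_eq] at hS hS'
    simp only [Prod.mk.injEq] at h
    ext v
    have h1 := Finset.ext_iff.1 h.1 v
    have h2 := Finset.ext_iff.1 h.2 v
    have h3 := @hS.2 v
    have h4 := @hS'.2 v
    simp only [mem_inter, mem_sdiff, mem_union] at h1 h2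
    tauto

theorem choose_sub_le_pow_mul {ρ : ℝ} (hρ0 : 0 ≤ ρ) (hρ : ρ ≤ 1) (i : ℕ) :
    ∀ {N X : ℕ}, (X : ℝ) ≤ ρ * N → i ≤ X →
      ((N - i).choose (X - i) : ℝ) ≤ ρ ^ i * N.choose X := by
  induction i with
  | zero => intro N X _ _; simp
  | succ i ih =>
    intro N X h hi
    obtain ⟨X, rfl⟩ : ∃ Y, X = Y + 1 := ⟨X - 1, by omega⟩
    rcases N with _ | N
    · push_cast at h
      have : (0 : ℝ) ≤ X := by positivity
      linarith
    push_cast at h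
    have h1 := ih (N := N) (X := X) (by nlinarith) (by omega)
    rw [show N + 1 - (i + 1) = N - i by omega, show X + 1 - (i + 1) = X - i by omega]
    have h2 : ((N : ℝ) + 1) * N.choose X = (N + 1).choose (X + 1) * (X + 1) := by
      exact_mod_cast Nat.add_one_mul_choose_eq N X
    have h3 : (N.choose X : ℝ) ≤ ρ * (N + 1).choose (X + 1) := by
      have h4 : ((N + 1).choose (X + 1) : ℝ) * (X + 1) ≤
          (N + 1).choose (X + 1) * (ρ * (N + 1)) := by gcongr
      have h5 : (0 : ℝ) < N + 1 := by positivity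
      refine le_of_mul_le_mul_left ?_ h5
      linarith
    calc ((N - i).choose (X - i) : ℝ) ≤ ρ ^ i * N.choose X := h1
      _ ≤ ρ ^ i * (ρ * (N + 1).choose (X + 1)) := by gcongr
      _ = _ := by ring

theorem pow_mul_choose_le (l a : ℕ) :
    ∀ {N X : ℕ}, l + 2 * a ≤ 2 * X → X ≤ N →
      l ^ a * N.choose X ≤ (2 * N) ^ a * (N - a).choose (X - a) := by
  induction a with
  | zero => intro N X _ _; simp
  | succ a ih =>
    intro N X h hXN
    obtain ⟨X, rfl⟩ : ∃ Y, X = Y + 1 := ⟨X - 1, by omega⟩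
    obtain ⟨N, rfl⟩ : ∃ Y, N = Y + 1 := ⟨N - 1, by omega⟩
    rw [show N + 1 - (a + 1) = N - a by omega, show X + 1 - (a + 1) = X - a by omega]
    have h1 := ih (N := N) (X := X) (by omega) (by omega)
    have h2 := Nat.add_one_mul_choose_eq N X
    calc l ^ (a + 1) * (N + 1).choose (X + 1)
        = l ^ a * ((N + 1).choose (X + 1) * l) := by ring
      _ ≤ l ^ a * ((N + 1).choose (X + 1) * (2 * (X + 1))) := by gcongr; omega
      _ = 2 * (N + 1) * (l ^ a * N.choose X) := by
        rw [show (N + 1).choose (X + 1) * (2 * (X + 1)) = 2 * ((N + 1).choose (X + 1) * (X + 1))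
          by ring, ← h2]; ring
      _ ≤ 2 * (N + 1) * ((2 * N) ^ a * (N - a).choose (X - a)) := by gcongr
      _ ≤ 2 * (N + 1) * ((2 * (N + 1)) ^ a * (N - a).choose (X - a)) := by gcongr; omega
      _ = _ := by ring

theorem choose_le_two_pow_mul (X c : ℕ) :
    ∀ {N : ℕ}, 2 * X + c ≤ N → N.choose X ≤ 2 ^ c * (N - c).choose X := by
  induction c with
  | zero => intro N _; simp
  | succ c ih =>
    intro N h
    obtain ⟨N, rfl⟩ : ∃ Y, N = Y + 1 := ⟨N - 1, by omega⟩
    have h1 := ih (N := N) (by omega)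
    have h2 : (N + 1).choose X ≤ 2 * N.choose X := by
      rcases X with _ | X
      · simp
      · have := Nat.choose_le_succ_of_lt_half_left (r := X) (n := N) (by omega)
        rw [Nat.choose_succ_succ']; omega
    rw [show N + 1 - (c + 1) = N - c by omega]
    calc _ ≤ 2 * N.choose X := h2
      _ ≤ 2 * (2 ^ c * (N - c).choose X) := by gcongr
      _ = _ := by ring

theorem pow_mul_choose_le_card_interSlice {A : Finset (Fin n)} {l x a : ℕ}
    (ha : a ≤ #A) (hx : l + 2 * a ≤ 2 * x) (hn : 2 * x + #A ≤ n) :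
    l ^ a * n.choose x ≤ 2 ^ #A * n ^ a * #(interSlice A x a) := by
  have h1 := pow_mul_choose_le l a (N := n) (X := x) hx (by omega)
  have h2 := choose_le_two_pow_mul (x - a) (#A - a) (N := n - a) (by omega)
  have h3 := le_card_interSlice (A := A) (x := x) (a := a) (by omega)
  rw [show n - a - (#A - a) = n - #A by omega] at h2
  have h4 : 1 ≤ (#A).choose a := Nat.choose_pos ha
  calc l ^ a * n.choose x ≤ (2 * n) ^ a * (n - a).choose (x - a) := h1
    _ ≤ (2 * n) ^ a * (2 ^ (#A - a) * (1 * (n - #A).choose (x - a))) := by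
      rw [one_mul]; gcongr
    _ ≤ (2 * n) ^ a * (2 ^ (#A - a) * #(interSlice A x a)) := by
      gcongr
      exact (Nat.mul_le_mul_right _ h4).trans h3
    _ = 2 ^ (a + (#A - a)) * n ^ a * #(interSlice A x a) := by rw [mul_pow, pow_add]; ring
    _ = _ := by rw [show a + (#A - a) = #A by omega]

theorem card_interSlice_filter_le {A B : Finset (Fin n)} {ρ : ℝ} (hρ0 : 0 ≤ ρ) (hρ : ρ ≤ 1)
    {x a : ℕ} (hx : (x : ℝ) ≤ ρ * ((n - #A : ℕ) : ℝ)) (ha : a ≤ x) :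
    (#{S ∈ interSlice A x a | #(S ∩ B) = a} : ℝ) ≤
      2 ^ #B * ρ ^ (a - #(A ∩ B)) * #(interSlice A x a) := by
  set i := a - #(A ∩ B) with hi
  have hone : ∀ I ∈ powersetCard i (B \ A),
      (#{S ∈ interSlice A x a | I ⊆ S} : ℝ) ≤ ρ ^ i * #(interSlice A x a) := by
    intro I hI
    obtain ⟨hIB, hIc⟩ := mem_powersetCard.1 hI
    have hdisj : Disjoint I A := disjoint_of_subset_left hIB sdiff_disjoint
    by_cases hia : i ≤ x - a
    · have h1 := card_interSlice_superset_le hdisj (x := x) (a := a)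
      have h2 := choose_sub_le_pow_mul hρ0 hρ i (N := n - #A) (X := x - a)
        (le_trans (by exact_mod_cast Nat.sub_le _ _) hx) hia
      have h3 := le_card_interSlice (A := A) ha
      rw [hIc] at h1
      calc (#{S ∈ interSlice A x a | I ⊆ S} : ℝ)
          ≤ (#A).choose a * (n - #A - i).choose (x - a - i) := by exact_mod_cast h1
        _ ≤ (#A).choose a * (ρ ^ i * (n - #A).choose (x - a)) := by gcongr
        _ = ρ ^ i * ((#A).choose a * (n - #A).choose (x - a) : ℕ) := by push_cast; ring
        _ ≤ _ := by gcongr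
    · have : {S ∈ interSlice A x a | I ⊆ S} = ∅ := by
        refine filter_eq_empty_iff.2 fun S hS hIS => hia ?_
        obtain ⟨h1, h2⟩ := mem_interSlice.1 hS
        have h3 : I ⊆ S \ A := fun v hv =>
          mem_sdiff.2 ⟨hIS hv, fun h => (disjoint_left.1 hdisj) hv h⟩
        have h4 := card_le_card h3
        have h5 := card_inter_add_card_sdiff S A
        omega
      rw [this]; simp; positivity
  have hcover : {S ∈ interSlice A x a | #(S ∩ B) = a} ⊆
      (powersetCard i (B \ A)).biUnion fun I => {S ∈ interSlice A x a | I ⊆ S} := by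
    intro S hS
    obtain ⟨hS, hSB⟩ := mem_filter.1 hS
    have h1 : i ≤ #(S ∩ (B \ A)) := by
      have h2 : S ∩ B ⊆ (S ∩ (B \ A)) ∪ (A ∩ B) := by
        intro v; simp only [mem_inter, mem_union, mem_sdiff]; tauto
      have := (card_le_card h2).trans (card_union_le _ _)
      omega
    obtain ⟨I, hI, hIc⟩ := exists_subset_card_eq h1
    refine mem_biUnion.2 ⟨I, mem_powersetCard.2 ⟨hI.trans inter_subset_right, hIc⟩, ?_⟩
    exact mem_filter.2 ⟨hS, hI.trans inter_subset_left⟩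
  have hnum : #(powersetCard i (B \ A)) ≤ 2 ^ #B := by
    rw [card_powersetCard]
    exact (Nat.choose_le_two_pow _ _).trans
      (Nat.pow_le_pow_right (by norm_num) (card_le_card sdiff_subset))
  calc (#{S ∈ interSlice A x a | #(S ∩ B) = a} : ℝ)
      ≤ ∑ I ∈ powersetCard i (B \ A), (#{S ∈ interSlice A x a | I ⊆ S} : ℝ) := by
        exact_mod_cast (card_le_card hcover).trans card_biUnion_le
    _ ≤ ∑ _I ∈ powersetCard i (B \ A), ρ ^ i * #(interSlice A x a) := sum_le_sum hone
    _ = #(powersetCard i (B \ A)) * (ρ ^ i * #(interSlice A x a)) := by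
      rw [sum_const, nsmul_eq_mul]
    _ ≤ (2 ^ #B : ℕ) * (ρ ^ i * #(interSlice A x a)) := by gcongr
    _ = _ := by push_cast; ring

end Slices

section Kikuchi

variable {n : ℕ}

/-- The indicator vector of a set over the two-element field. -/
def indVec (C : Finset (Fin n)) : Fin n → ZMod 2 := fun v => if v ∈ C then 1 else 0

theorem indVec_symmDiff (A B : Finset (Fin n)) : indVec (symmDiff A B) = indVec A + indVec B := by
  have h2 : (1 : ZMod 2) + 1 = 0 := by decide
  ext v
  by_cases hA : v ∈ A <;> by_cases hB : v ∈ B <;> simp [indVec, mem_symmDiff, hA, hB, h2]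

theorem card_symmDiff_add (S A : Finset (Fin n)) :
    #(symmDiff S A) + 2 * #(S ∩ A) = #S + #A := by
  have h1 := card_inter_add_card_sdiff S A
  have h2 := card_inter_add_card_sdiff A S
  have h3 : #(symmDiff S A) = #(S \ A) + #(A \ S) :=
    card_union_of_disjoint disjoint_sdiff_sdiff
  rw [inter_comm A S] at h2
  omega

theorem card_symmDiff_inter_add (S A : Finset (Fin n)) :
    #(symmDiff S A ∩ A) + #(S ∩ A) = #A := by
  have h1 : symmDiff S A ∩ A = A \ S := by
    ext v; simp only [mem_inter, mem_symmDiff, mem_sdiff]; tauto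
  rw [h1, inter_comm]
  have := card_inter_add_card_sdiff A S
  omega

/-- The darts of the two-sided Kikuchi graph: `(S₁, S₂)` meets the reduced hyperedges of a
pair in `a₁` and `a₂` vertices respectively. -/
def kikuchiDarts (P : Finset (Finset (Fin n) × Finset (Fin n)))
    (R : Finset (Fin n) → Finset (Fin n)) (x y a₁ a₂ : ℕ) :
    Finset ((Finset (Fin n) × Finset (Fin n)) × Finset (Fin n) × Finset (Fin n)) :=
  {d ∈ univ ×ˢ P | d.1 ∈ interSlice (R d.2.1) x a₁ ×ˢ interSlice (R d.2.2) y a₂}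

/-- The other end of a dart; the two coordinates are swapped, which makes the construction
insensitive to parity. -/
def kikuchiNext (R : Finset (Fin n) → Finset (Fin n))
    (d : (Finset (Fin n) × Finset (Fin n)) × Finset (Fin n) × Finset (Fin n)) :
    Finset (Fin n) × Finset (Fin n) :=
  (symmDiff d.1.2 (R d.2.2), symmDiff d.1.1 (R d.2.1))

variable {P : Finset (Finset (Fin n) × Finset (Fin n))} {R : Finset (Fin n) → Finset (Fin n)}
  {x y a₁ a₂ b : ℕ}

theorem mem_kikuchiDarts
    {d : (Finset (Fin n) × Finset (Fin n)) × Finset (Fin n) × Finset (Fin n)} :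
    d ∈ kikuchiDarts P R x y a₁ a₂ ↔
      d.2 ∈ P ∧ d.1 ∈ interSlice (R d.2.1) x a₁ ×ˢ interSlice (R d.2.2) y a₂ := by
  simp [kikuchiDarts]

theorem sum_kikuchiDarts {β : Type*} [AddCommMonoid β]
    (F : (Finset (Fin n) × Finset (Fin n)) × Finset (Fin n) × Finset (Fin n) → β) :
    ∑ d ∈ kikuchiDarts P R x y a₁ a₂, F d = ∑ p ∈ P,
      ∑ S ∈ interSlice (R p.1) x a₁ ×ˢ interSlice (R p.2) y a₂, F (S, p) :=
  sum_finset_product_right _ _ _ fun _ => mem_kikuchiDarts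

theorem card_kikuchiDarts :
    #(kikuchiDarts P R x y a₁ a₂) =
      ∑ p ∈ P, #(interSlice (R p.1) x a₁) * #(interSlice (R p.2) y a₂) := by
  rw [card_eq_sum_ones, sum_kikuchiDarts]
  simp

theorem sum_card_partner_le {N : Finset (Finset (Fin n))} {A : Finset (Fin n)} {ρ : ℝ}
    (hρ0 : 0 ≤ ρ) (hρ : ρ ≤ 1) (hx : (x : ℝ) ≤ ρ * ((n - #A : ℕ) : ℝ)) {a K : ℕ} (ha : a ≤ x)
    (hN : ∀ C ∈ N, #(R C) = b)
    (hK : ∑ C ∈ N, 2 ^ b * ρ ^ (a - #(A ∩ R C)) ≤ (K : ℝ)) :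
    ∑ S ∈ interSlice A x a, #{C ∈ N | #(S ∩ R C) = a} ≤ K * #(interSlice A x a) := by
  have h1 : ∑ S ∈ interSlice A x a, #{C ∈ N | #(S ∩ R C) = a} =
      ∑ C ∈ N, #{S ∈ interSlice A x a | #(S ∩ R C) = a} := by
    simp only [card_filter]
    exact sum_comm
  rw [h1]
  have h2 : (∑ C ∈ N, #{S ∈ interSlice A x a | #(S ∩ R C) = a} : ℝ) ≤
      K * #(interSlice A x a) := by
    calc (∑ C ∈ N, #{S ∈ interSlice A x a | #(S ∩ R C) = a} : ℝ)
        ≤ ∑ C ∈ N, 2 ^ b * ρ ^ (a - #(A ∩ R C)) * #(interSlice A x a) := by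
          refine sum_le_sum fun C hC => ?_
          rw [← hN C hC]
          exact card_interSlice_filter_le hρ0 hρ hx ha
      _ = (∑ C ∈ N, 2 ^ b * ρ ^ (a - #(A ∩ R C))) * #(interSlice A x a) := by
          rw [sum_mul]
      _ ≤ _ := by gcongr
  exact_mod_cast h2

/-- The Kikuchi graph of a symmetric system `P` of pairs of hyperedges, with reduced hyperedges
`R C` of size `b`, yields two distinct small sets of hyperedges with equal sums. -/
theorem exists_ne_sum_indVec_eq {l r K : ℕ} {ρ : ℝ}
    (hPsymm : ∀ p ∈ P, p.swap ∈ P) (hPne : ∀ p ∈ P, p.1 ≠ p.2)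
    (hR : ∀ p ∈ P, #(R p.1) = b)
    (hvec : ∀ p ∈ P, indVec (R p.1) + indVec (R p.2) = indVec p.1 + indVec p.2)
    (hb : 1 ≤ b) (hbl : 2 * b ≤ l) (hln : 4 * l ≤ n) (hρ : ρ * n = 4 * l) (hK0 : 0 < K)
    (hK : ∀ p ∈ P, ∀ a ≤ b, b ≤ 2 * a + 1 →
      ∑ C ∈ univ with (p.1, C) ∈ P, 2 ^ b * ρ ^ (a - #(R p.2 ∩ R C)) ≤ (K : ℝ))
    (hP : 256 * (r * K) * (4 ^ b * n ^ b) ≤ l ^ b * #P) (hr : n ^ (3 * l) < 2 ^ r) :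
    ∃ U U' : Finset (Finset (Fin n)), U ≠ U' ∧ #U ≤ 2 * r ∧ #U' ≤ 2 * r ∧
      ∑ C ∈ U, indVec C = ∑ C ∈ U', indVec C ∧ ∀ C ∈ U ∪ U', ∃ p ∈ P, C = p.1 := by
  obtain ⟨a₁, a₂, hab, ha12, ha21⟩ : ∃ a₁ a₂ : ℕ, a₁ + a₂ = b ∧ a₁ ≤ a₂ ∧ a₂ ≤ a₁ + 1 :=
    ⟨b / 2, b - b / 2, by omega, by omega, by omega⟩
  set y := l + (a₂ - a₁) with hy
  have hR' : ∀ p ∈ P, #(R p.2) = b := fun p hp => hR _ (hPsymm p hp)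
  have hn0 : (0 : ℝ) < n := by exact_mod_cast (by omega : 0 < n)
  have hlnR : (4 * l : ℝ) ≤ n := by exact_mod_cast hln
  have hρ0 : 0 ≤ ρ := by
    by_contra! h
    have : ρ * n < 0 := mul_neg_of_neg_of_pos h hn0
    have : (0 : ℝ) ≤ l := by positivity
    linarith
  have hρ1 : ρ ≤ 1 := by
    by_contra! h
    nlinarith
  have hxρ : ∀ x : ℕ, x ≤ 2 * l → (x : ℝ) ≤ ρ * ((n - b : ℕ) : ℝ) := by
    intro x hx
    have h1 : (x : ℝ) ≤ 2 * l := by exact_mod_cast hx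
    have h2 : (n : ℝ) ≤ 2 * ((n - b : ℕ) : ℝ) := by exact_mod_cast (by omega : n ≤ 2 * (n - b))
    have h3 := mul_le_mul_of_nonneg_left h2 hρ0
    linarith
  set D := kikuchiDarts P R l y a₁ a₂ with hD
  have hmem : ∀ d ∈ D, d.2 ∈ P ∧ (#d.1.1 = l ∧ #(d.1.1 ∩ R d.2.1) = a₁) ∧
      #d.1.2 = y ∧ #(d.1.2 ∩ R d.2.2) = a₂ := by
    intro d hd
    obtain ⟨h1, h2⟩ := mem_kikuchiDarts.1 hd
    obtain ⟨h3, h4⟩ := mem_product.1 h2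
    exact ⟨h1, mem_interSlice.1 h3, mem_interSlice.1 h4⟩
  have hrev : ∀ d ∈ D, revDart (kikuchiNext R) d ∈ D := by
    intro d hd
    obtain ⟨h1, ⟨h2, h3⟩, h4, h5⟩ := hmem d hd
    refine mem_kikuchiDarts.2 ⟨hPsymm _ h1, mem_product.2 ⟨mem_interSlice.2 ?_,
      mem_interSlice.2 ?_⟩⟩
    · have e1 := card_symmDiff_add d.1.2 (R d.2.2)
      have e2 := card_symmDiff_inter_add d.1.2 (R d.2.2)
      rw [hR' _ h1] at e1 e2
      simp only [revDart, kikuchiNext]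
      omega
    · have e1 := card_symmDiff_add d.1.1 (R d.2.1)
      have e2 := card_symmDiff_inter_add d.1.1 (R d.2.1)
      rw [hR _ h1] at e1 e2
      simp only [revDart, kikuchiNext]
      omega
  have hcardD : #D = ∑ p ∈ P, #(interSlice (R p.1) l a₁) * #(interSlice (R p.2) y a₂) :=
    card_kikuchiDarts
  have hK₁ : ∑ d ∈ D, #{e ∈ D | e.1 = d.1 ∧ e.2.1 = d.2.1} ≤ K * #D := by
    have hpart : ∀ d ∈ D, #{e ∈ D | e.1 = d.1 ∧ e.2.1 = d.2.1} ≤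
        #{C ∈ ({C | (d.2.1, C) ∈ P} : Finset (Finset (Fin n))) | #(d.1.2 ∩ R C) = a₂} := by
      intro d _
      refine card_le_card_of_injOn (fun e => e.2.2) ?_ ?_
      · intro e he
        obtain ⟨he, h1, h2⟩ := mem_filter.1 (mem_coe.1 he)
        have := hmem e he
        simp only [mem_coe, mem_filter, mem_univ, true_and]
        rw [← h1, ← h2]
        exact ⟨this.1, this.2.2.2⟩
      · intro e he e' he' h
        obtain ⟨_, h1, h2⟩ := mem_filter.1 (mem_coe.1 he)
        obtain ⟨_, h1', h2'⟩ := mem_filter.1 (mem_coe.1 he')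
        exact Prod.ext (h1.trans h1'.symm) (Prod.ext (h2.trans h2'.symm) h)
    refine (sum_le_sum hpart).trans ?_
    rw [hcardD, hD, sum_kikuchiDarts, mul_sum]
    refine sum_le_sum fun p hp => ?_
    rw [sum_product]
    dsimp only
    have := sum_card_partner_le (R := R) (N := {C | (p.1, C) ∈ P}) (A := R p.2) (x := y)
      (a := a₂) (K := K) (b := b) hρ0 hρ1 (by rw [hR' p hp]; exact hxρ _ (by omega)) (by omega)
      (fun C hC => hR' (p.1, C) (by simpa using hC)) (hK p hp a₂ (by omega) (by omega))
    exact (sum_le_card_nsmul _ _ _ fun _ _ => this).trans_eq (by rw [smul_eq_mul]; ring)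
  have hK₂ : ∑ d ∈ D, #{e ∈ D | e.1 = d.1 ∧ e.2.2 = d.2.2} ≤ K * #D := by
    have hpart : ∀ d ∈ D, #{e ∈ D | e.1 = d.1 ∧ e.2.2 = d.2.2} ≤
        #{C ∈ ({C | (d.2.2, C) ∈ P} : Finset (Finset (Fin n))) | #(d.1.1 ∩ R C) = a₁} := by
      intro d _
      refine card_le_card_of_injOn (fun e => e.2.1) ?_ ?_
      · intro e he
        obtain ⟨he, h1, h2⟩ := mem_filter.1 (mem_coe.1 he)
        have := hmem e he
        simp only [mem_coe, mem_filter, mem_univ, true_and]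
        rw [← h1, ← h2]
        exact ⟨hPsymm _ this.1, this.2.1.2⟩
      · intro e he e' he' h
        obtain ⟨_, h1, h2⟩ := mem_filter.1 (mem_coe.1 he)
        obtain ⟨_, h1', h2'⟩ := mem_filter.1 (mem_coe.1 he')
        exact Prod.ext (h1.trans h1'.symm) (Prod.ext h (h2.trans h2'.symm))
    refine (sum_le_sum hpart).trans ?_
    rw [hcardD, hD, sum_kikuchiDarts, mul_sum]
    refine sum_le_sum fun p hp => ?_
    rw [sum_product_right]
    dsimp only
    have := sum_card_partner_le (R := R) (N := {C | (p.2, C) ∈ P}) (A := R p.1) (x := l)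
      (a := a₁) (K := K) (b := b) hρ0 hρ1 (by rw [hR p hp]; exact hxρ _ (by omega)) (by omega)
      (fun C hC => hR' (p.2, C) (by simpa using hC))
      (hK p.swap (hPsymm p hp) a₁ (by omega) (by omega))
    exact (sum_le_card_nsmul _ _ _ fun _ _ => this).trans_eq (by rw [smul_eq_mul]; ring)
  let W : Finset (Finset (Fin n) × Finset (Fin n)) :=
    powersetCard l univ ×ˢ powersetCard y univ
  have hWcard : #W = n.choose l * n.choose y := by
    rw [card_product, card_powersetCard, card_powersetCard, card_univ, Fintype.card_fin]
  have hWne : W.Nonempty := by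
    rw [← card_pos, hWcard]
    exact Nat.mul_pos (Nat.choose_pos (by omega)) (Nat.choose_pos (by omega))
  have hdense : 256 * (r * K) * #W ≤ #D := by
    have hslice : l ^ b * #W * #P ≤ 4 ^ b * n ^ b * #D := by
      rw [hcardD, mul_sum, mul_comm, ← smul_eq_mul]
      refine card_nsmul_le_sum _ _ _ fun p hp => ?_
      have h1 := pow_mul_choose_le_card_interSlice (A := R p.1) (l := l) (x := l) (a := a₁)
        (by rw [hR p hp]; omega) (by omega) (by rw [hR p hp]; omega)
      have h2 := pow_mul_choose_le_card_interSlice (A := R p.2) (l := l) (x := y) (a := a₂)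
        (by rw [hR' p hp]; omega) (by omega) (by rw [hR' p hp]; omega)
      rw [hR p hp] at h1
      rw [hR' p hp] at h2
      calc l ^ b * #W = (l ^ a₁ * n.choose l) * (l ^ a₂ * n.choose y) := by
            rw [hWcard, ← hab, pow_add]; ring
        _ ≤ _ := Nat.mul_le_mul h1 h2
        _ = (2 * 2) ^ b * n ^ (a₁ + a₂) *
            (#(interSlice (R p.1) l a₁) * #(interSlice (R p.2) y a₂)) := by
            rw [mul_pow, pow_add]; ring
        _ = _ := by rw [hab]
    have hpos : 0 < 4 ^ b * n ^ b := Nat.mul_pos (by positivity) (pow_pos (by omega) _)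
    refine Nat.le_of_mul_le_mul_left ?_ hpos
    calc 4 ^ b * n ^ b * (256 * (r * K) * #W)
        = 256 * (r * K) * (4 ^ b * n ^ b) * #W := by ring
      _ ≤ l ^ b * #P * #W := Nat.mul_le_mul_right _ hP
      _ = l ^ b * #W * #P := by ring
      _ ≤ _ := hslice
  obtain ⟨U, U', h1, h2, h3, h4, h5⟩ := exists_ne_sum_eq_of_dense (D := D)
    (next := kikuchiNext R) (vec := indVec) (f := fun S => indVec S.1 + indVec S.2) (r := r)
    (W := W) hrev
    (fun d _ => by simp [revDart, kikuchiNext])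
    (fun d hd => hPne _ (hmem d hd).1) hK0 hK₁ hK₂
    (fun d hd => by
      have := hvec _ (hmem d hd).1
      simp only [kikuchiNext, indVec_symmDiff]
      rw [add_assoc (indVec d.1.1 + indVec d.1.2), ← this]
      abel)
    hWne
    (fun d hd => by
      obtain ⟨_, ⟨h2, _⟩, h4, _⟩ := hmem d hd
      simp [W, h2, h4])
    hdense
    (by
      refine lt_of_le_of_lt ?_ hr
      rw [hWcard]
      calc n.choose l * n.choose y ≤ n ^ l * n ^ y :=
            Nat.mul_le_mul (Nat.choose_le_pow _ _) (Nat.choose_le_pow _ _)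
        _ = n ^ (l + y) := (pow_add _ _ _).symm
        _ ≤ n ^ (3 * l) := Nat.pow_le_pow_right (by omega) (by omega))
  exact ⟨U, U', h1, h2, h3, h4, fun C hC => by
    obtain ⟨d, hd, rfl⟩ := h5 C hC
    exact ⟨d.2, (hmem d hd).1, rfl⟩⟩

end Kikuchi

section Buckets

variable {n : ℕ}

/-- Greedy decomposition: at some level `s` a large part of the hypergraph splits into disjoint
buckets of `M s` hyperedges through a common `s`-set, while larger sets have small degree. -/
theorem exists_bucket_family {M : ℕ → ℕ} (hM : ∀ s, 0 < M s) {W : ℝ} (t : ℕ) :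
    ∀ G : Finset (Finset (Fin n)), (∀ C ∈ G, C.Nonempty) →
      (∀ Q : Finset (Fin n), t < #Q → #{C ∈ G | Q ⊆ C} ≤ M #Q) →
      t * W + n * M 1 < #G →
      ∃ s, 1 ≤ s ∧ s ≤ t ∧ ∃ G' ⊆ G,
        (∀ Q : Finset (Fin n), s < #Q → #{C ∈ G' | Q ⊆ C} ≤ M #Q) ∧
        ∃ 𝓑 : Finset (Finset (Finset (Fin n))),
          (𝓑 : Set (Finset (Finset (Fin n)))).PairwiseDisjoint id ∧
          (∀ B ∈ 𝓑, B ⊆ G' ∧ #B = M s ∧ ∃ Q : Finset (Fin n), #Q = s ∧ ∀ C ∈ B, Q ⊆ C) ∧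
          W ≤ #(𝓑.biUnion id) := by
  induction t with
  | zero =>
    intro G hne hdeg hG
    exfalso
    have hcover : G ⊆ univ.biUnion fun v : Fin n => {C ∈ G | {v} ⊆ C} := by
      intro C hC
      obtain ⟨v, hv⟩ := hne C hC
      simpa [hC] using ⟨v, hv⟩
    have h1 := (card_le_card hcover).trans (card_biUnion_le_card_mul univ _ (M 1)
      fun v _ => by simpa using hdeg {v} (by simp))
    rw [card_univ, Fintype.card_fin] at h1
    have h2 : (#G : ℝ) ≤ n * M 1 := by exact_mod_cast h1
    simp only [Nat.cast_zero, zero_mul, zero_add] at hG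
    linarith
  | succ t ih =>
    intro G hne hdeg hG
    classical
    let valid : Finset (Finset (Finset (Fin n))) → Prop := fun 𝓑 =>
      (𝓑 : Set (Finset (Finset (Fin n)))).PairwiseDisjoint id ∧ ∀ B ∈ 𝓑, B ⊆ G ∧ #B = M (t + 1) ∧
        ∃ Q : Finset (Fin n), #Q = t + 1 ∧ ∀ C ∈ B, Q ⊆ C
    obtain ⟨𝓑, h𝓑, hmax⟩ := exists_max_image ({𝓑 | valid 𝓑} : Finset _) card
      ⟨∅, by simp [valid]⟩
    simp only [mem_filter, mem_univ, true_and] at h𝓑 hmax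
    by_cases hW : W ≤ #(𝓑.biUnion id)
    · exact ⟨t + 1, by omega, le_rfl, G, Subset.rfl, hdeg, 𝓑, h𝓑.1, h𝓑.2, hW⟩
    have hsub : 𝓑.biUnion id ⊆ G := biUnion_subset.2 fun B hB => (h𝓑.2 B hB).1
    have hdeg' : ∀ Q : Finset (Fin n), t < #Q → #{C ∈ G \ 𝓑.biUnion id | Q ⊆ C} ≤ M #Q := by
      intro Q hQ
      rcases (Nat.succ_le_of_lt hQ).lt_or_eq with hlt | heq
      · exact (card_le_card (filter_subset_filter _ sdiff_subset)).trans (hdeg Q hlt)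
      by_contra! hlarge
      obtain ⟨B, hB, hBc⟩ := exists_subset_card_eq hlarge.le
      have hBG : ∀ C ∈ B, (C ∈ G ∧ C ∉ 𝓑.biUnion id) ∧ Q ⊆ C := fun C hC => by
        simpa only [mem_filter, mem_sdiff] using hB hC
      have hdisj : ∀ B' ∈ 𝓑, Disjoint B B' := fun B' hB' =>
        disjoint_left.2 fun C hC hC' => (hBG C hC).1.2 (mem_biUnion.2 ⟨B', hB', hC'⟩)
      have hBnot : B ∉ 𝓑 := fun hmem => by
        have h0 : B = ∅ := disjoint_self.1 (hdisj B hmem)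
        rw [h0, card_empty] at hBc
        exact (hM _).ne hBc
      have := hmax (insert B 𝓑) ⟨?_, ?_⟩
      · rw [card_insert_of_notMem hBnot] at this
        omega
      · rw [coe_insert]
        exact h𝓑.1.insert fun B' hB' _ => hdisj B' hB'
      · intro B' hB'
        rcases mem_insert.1 hB' with rfl | hB'
        · exact ⟨fun C hC => (hBG C hC).1.1, by rw [hBc, ← heq], Q, heq.symm,
            fun C hC => (hBG C hC).2⟩
        · exact h𝓑.2 B' hB'
    have hcard : t * W + n * M 1 < #(G \ 𝓑.biUnion id) := by
      have h1 : (#(G \ 𝓑.biUnion id) : ℝ) + #(𝓑.biUnion id) = #G := by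
        exact_mod_cast card_sdiff_add_card_eq_card hsub
      push_cast at hG
      linarith
    obtain ⟨s, hs1, hst, G', hG', h⟩ := ih (G \ 𝓑.biUnion id)
      (fun C hC => hne C (mem_sdiff.1 hC).1) hdeg' hcard
    exact ⟨s, hs1, by omega, G', hG'.trans sdiff_subset, h⟩

theorem exists_pair_system {M : ℕ → ℕ} {k s : ℕ} {G : Finset (Finset (Fin n))}
    (hk : ∀ C ∈ G, #C = k)
    (hdeg : ∀ Q : Finset (Fin n), s < #Q → #{C ∈ G | Q ⊆ C} ≤ M #Q)
    {𝓑 : Finset (Finset (Finset (Fin n)))}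
    (hdisj : (𝓑 : Set (Finset (Finset (Fin n)))).PairwiseDisjoint id)
    (h𝓑 : ∀ B ∈ 𝓑, B ⊆ G ∧ #B = M s ∧ ∃ Q : Finset (Fin n), #Q = s ∧ ∀ C ∈ B, Q ⊆ C) :
    ∃ (P : Finset (Finset (Fin n) × Finset (Fin n))) (R : Finset (Fin n) → Finset (Fin n)),
      (∀ p ∈ P, p.swap ∈ P) ∧ (∀ p ∈ P, p.1 ≠ p.2) ∧ (∀ p ∈ P, p.1 ∈ G) ∧
      (∀ p ∈ P, #(R p.1) = k - s) ∧
      (∀ p ∈ P, indVec (R p.1) + indVec (R p.2) = indVec p.1 + indVec p.2) ∧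
      (∀ p ∈ P, ∀ J ⊆ R p.2, #{C | (p.1, C) ∈ P ∧ R p.2 ∩ R C = J} ≤ M (s + #J)) ∧
      #P = #(𝓑.biUnion id) * (M s - 1) := by
  classical
  choose! q hq using fun B hB => (h𝓑 B hB).2.2
  have huniq : ∀ B ∈ 𝓑, ∀ B' ∈ 𝓑, ∀ C ∈ B, C ∈ B' → B = B' := fun B hB B' hB' C hC hC' => by
    by_contra hne
    exact (disjoint_left.1 (hdisj hB hB' hne)) hC hC'
  obtain ⟨R, hR⟩ : ∃ R : Finset (Fin n) → Finset (Fin n), ∀ B ∈ 𝓑, ∀ C ∈ B, R C = C \ q B := by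
    refine ⟨fun C => if h : ∃ B ∈ 𝓑, C ∈ B then C \ q h.choose else ∅, fun B hB C hC => ?_⟩
    have h : ∃ B ∈ 𝓑, C ∈ B := ⟨B, hB, hC⟩
    dsimp only
    rw [dif_pos h, huniq _ h.choose_spec.1 B hB C h.choose_spec.2 hC]
  let P := 𝓑.biUnion offDiag
  have hP : ∀ p : Finset (Fin n) × Finset (Fin n),
      p ∈ P ↔ ∃ B ∈ 𝓑, p.1 ∈ B ∧ p.2 ∈ B ∧ p.1 ≠ p.2 := fun p => by
    simp [P]
  have hRvec : ∀ B ∈ 𝓑, ∀ C ∈ B, indVec (R C) = indVec C + indVec (q B) := by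
    intro B hB C hC
    rw [← indVec_symmDiff, hR B hB C hC]
    congr 1
    have := (hq B hB).2 C hC
    rw [symmDiff_def, sup_eq_union, sdiff_eq_empty_iff_subset.2 this, union_empty]
  have hadd : ∀ w : Fin n → ZMod 2, w + w = 0 := fun w => by
    ext v; exact CharTwo.add_self_eq_zero _
  refine ⟨P, R, ?_, ?_, ?_, ?_, ?_, ?_, ?_⟩
  · intro p hp
    obtain ⟨B, hB, h1, h2, h3⟩ := (hP p).1 hp
    exact (hP _).2 ⟨B, hB, h2, h1, h3.symm⟩
  · intro p hp
    obtain ⟨B, hB, h1, h2, h3⟩ := (hP p).1 hp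
    exact h3
  · intro p hp
    obtain ⟨B, hB, h1, h2, h3⟩ := (hP p).1 hp
    exact (h𝓑 B hB).1 h1
  · intro p hp
    obtain ⟨B, hB, h1, h2, h3⟩ := (hP p).1 hp
    rw [hR B hB _ h1, card_sdiff_of_subset ((hq B hB).2 _ h1), (hq B hB).1,
      hk _ ((h𝓑 B hB).1 h1)]
  · intro p hp
    obtain ⟨B, hB, h1, h2, h3⟩ := (hP p).1 hp
    rw [hRvec B hB _ h1, hRvec B hB _ h2, add_add_add_comm, hadd, add_zero]
  · intro p hp J hJ
    obtain ⟨B, hB, h1, h2, h3⟩ := (hP p).1 hp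
    have hR2 := hR B hB _ h2
    have hpart : ∀ C, (p.1, C) ∈ P → C ∈ B := by
      intro C hC
      obtain ⟨B', hB', h1', h2', _⟩ := (hP _).1 hC
      rwa [huniq B hB B' hB' _ h1 h1']
    rcases J.eq_empty_or_nonempty with rfl | hJne
    · rw [card_empty, add_zero, ← (h𝓑 B hB).2.1]
      exact card_le_card fun C hC => hpart C (mem_filter.1 hC).2.1
    · have hcard : #(q B ∪ J) = s + #J := by
        rw [card_union_of_disjoint, (hq B hB).1]
        exact disjoint_of_subset_right (hR2 ▸ hJ) disjoint_sdiff
      have := hdeg (q B ∪ J) (by have := hJne.card_pos; omega)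
      rw [hcard] at this
      refine le_trans (card_le_card fun C hC => ?_) this
      obtain ⟨_, hC, hJC⟩ := mem_filter.1 hC
      have hCB := hpart C hC
      refine mem_filter.2 ⟨(h𝓑 B hB).1 hCB, union_subset ((hq B hB).2 C hCB) ?_⟩
      rw [← hJC, hR B hB C hCB]
      exact inter_subset_right.trans sdiff_subset
  · have h1 : #P = ∑ B ∈ 𝓑, #B.offDiag := by
      refine card_biUnion fun B hB B' hB' hne => disjoint_left.2 fun p hp hp' => ?_
      exact (disjoint_left.1 (hdisj hB hB' hne)) (mem_offDiag.1 hp).1 (mem_offDiag.1 hp').1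
    rw [h1, card_biUnion (fun B hB B' hB' hne => hdisj hB hB' hne), sum_mul]
    refine sum_congr rfl fun B hB => ?_
    rw [offDiag_card, id, (h𝓑 B hB).2.1, Nat.mul_sub_one]

theorem sum_partner_weight_le {P : Finset (Finset (Fin n) × Finset (Fin n))}
    {R : Finset (Fin n) → Finset (Fin n)} {M : ℕ → ℕ} {q : ℝ} (hq : 1 ≤ q) {k s a : ℕ}
    (hs1 : 1 ≤ s) (hab : a ≤ k - s) (hba : k - s ≤ 2 * a + 1)
    (hM : ∀ s, (M s : ℝ) ≤ 3 * q ^ (k - 2 * s))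
    {p : Finset (Fin n) × Finset (Fin n)} (hR : #(R p.2) = k - s)
    (hdeg : ∀ J ⊆ R p.2, #{C | (p.1, C) ∈ P ∧ R p.2 ∩ R C = J} ≤ M (s + #J)) :
    ∑ C ∈ univ with (p.1, C) ∈ P, 2 ^ (k - s) * (4 / q ^ 2) ^ (a - #(R p.2 ∩ R C)) ≤
      ((3 * 16 ^ (k - s) : ℕ) : ℝ) := by
  have hq0 : 0 < q := by linarith
  have hone : ∀ J ∈ (R p.2).powerset,
      ∑ C ∈ {C ∈ ({C | (p.1, C) ∈ P} : Finset (Finset (Fin n))) | R p.2 ∩ R C = J},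
        2 ^ (k - s) * (4 / q ^ 2) ^ (a - #(R p.2 ∩ R C)) ≤ 2 ^ (k - s) * (3 * 4 ^ (k - s)) := by
    intro J hJ
    have h1 : ∀ C ∈ {C ∈ ({C | (p.1, C) ∈ P} : Finset (Finset (Fin n))) | R p.2 ∩ R C = J},
        2 ^ (k - s) * (4 / q ^ 2) ^ (a - #(R p.2 ∩ R C)) =
          2 ^ (k - s) * (4 / q ^ 2) ^ (a - #J) := fun C hC => by
      rw [(mem_filter.1 hC).2]
    rw [sum_congr rfl h1, sum_const, nsmul_eq_mul, filter_filter]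
    have h2 : (#{C | (p.1, C) ∈ P ∧ R p.2 ∩ R C = J} : ℝ) ≤ 3 * q ^ (k - 2 * (s + #J)) :=
      le_trans (by exact_mod_cast hdeg J (mem_powerset.1 hJ)) (hM _)
    have h3 : q ^ (k - 2 * (s + #J)) ≤ (q ^ 2) ^ (a - #J) := by
      rw [← pow_mul]
      exact pow_le_pow_right₀ hq (by omega)
    calc _ ≤ 3 * (q ^ 2) ^ (a - #J) * (2 ^ (k - s) * (4 / q ^ 2) ^ (a - #J)) :=
          mul_le_mul_of_nonneg_right (h2.trans (mul_le_mul_of_nonneg_left h3 (by norm_num)))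
            (by positivity)
      _ = 2 ^ (k - s) * (3 * 4 ^ (a - #J)) := by
          rw [div_pow]; field_simp
      _ ≤ _ := by
          have : (4 : ℝ) ^ (a - #J) ≤ 4 ^ (k - s) := pow_le_pow_right₀ (by norm_num) (by omega)
          gcongr
  rw [← sum_fiberwise_of_maps_to (t := (R p.2).powerset) (g := fun C => R p.2 ∩ R C)
    (fun C _ => mem_powerset.2 inter_subset_left)]
  refine (sum_le_sum hone).trans ?_
  rw [sum_const, card_powerset, hR, nsmul_eq_mul]
  push_cast
  rw [show (16 : ℝ) = 2 * 2 * 4 by norm_num, mul_pow, mul_pow]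
  exact le_of_eq (by ring)

end Buckets

section EvenCovers

variable {n : ℕ}

theorem exists_isEvenCover_of_sum_eq {H U U' : Finset (Finset (Fin n))} (hU : U ∪ U' ⊆ H)
    (hne : U ≠ U') (hsum : ∑ C ∈ U, indVec C = ∑ C ∈ U', indVec C) :
    ∃ E, IsEvenCover H E ∧ E ⊆ U ∪ U' := by
  have hsub : symmDiff U U' ⊆ U ∪ U' := fun C => by
    simp only [mem_symmDiff, mem_union]; tauto
  refine ⟨symmDiff U U', ⟨hsub.trans hU, ?_, fun v => ?_⟩, hsub⟩
  · rw [nonempty_iff_ne_empty]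
    exact fun h => hne (symmDiff_eq_bot.1 h)
  · have h1 : ∀ T : Finset (Finset (Fin n)),
        (∑ C ∈ T, indVec C) v = ((#{C ∈ T | v ∈ C} : ℕ) : ZMod 2) := fun T => by
      rw [Finset.sum_apply, card_filter]
      simp [indVec]
    have h2 := congrFun hsum v
    rw [h1, h1, ZMod.natCast_eq_natCast_iff'] at h2
    have h3 : {C ∈ symmDiff U U' | v ∈ C} =
        symmDiff {C ∈ U | v ∈ C} {C ∈ U' | v ∈ C} := by
      ext C; simp only [mem_filter, mem_symmDiff]; tauto
    have h4 := card_inter_add_card_sdiff {C ∈ U | v ∈ C} {C ∈ U' | v ∈ C}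
    have h5 := card_inter_add_card_sdiff {C ∈ U' | v ∈ C} {C ∈ U | v ∈ C}
    have h6 : #(symmDiff {C ∈ U | v ∈ C} {C ∈ U' | v ∈ C}) = _ :=
      card_union_of_disjoint disjoint_sdiff_sdiff
    rw [inter_comm] at h5
    rw [h3, Nat.even_iff]
    omega

theorem exists_isEvenCover_of_lt_card {H : Finset (Finset (Fin n))} (hH : n < #H) :
    ∃ E, IsEvenCover H E ∧ #E ≤ n + 1 := by
  obtain ⟨T, hT, hTc⟩ := exists_subset_card_eq (Nat.succ_le_of_lt hH)
  obtain ⟨U, hU, U', hU', hne, h⟩ := exists_ne_map_eq_of_card_lt_of_maps_to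
    (s := T.powerset) (t := (univ : Finset (Fin n → ZMod 2)))
    (by
      rw [card_powerset, hTc, card_univ, Fintype.card_fun, ZMod.card, Fintype.card_fin]
      exact Nat.pow_lt_pow_right (by norm_num) (Nat.lt_succ_self n))
    (f := fun U => ∑ C ∈ U, indVec C) (fun _ _ => by simp)
  have hsub : U ∪ U' ⊆ T := union_subset (mem_powerset.1 hU) (mem_powerset.1 hU')
  obtain ⟨E, hE, hEU⟩ := exists_isEvenCover_of_sum_eq (hsub.trans hT) hne h
  exact ⟨E, hE, (card_le_card (hEU.trans hsub)).trans_eq hTc⟩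

end EvenCovers

/-- **Feige's conjecture.** There exist absolute constants `Γ > 0` and
`c > 0` such that for every `k ≥ 2` and integers `n, ℓ` with `2(k−1) ≤ ℓ ≤ n`, every
`k`-uniform hypergraph on `[n]` with at least `Γ^k · n · (n/ℓ)^{k/2−1} · (log₂ n)^{4k+1}`
hyperedges contains an even cover of length at most `c·ℓ·log₂ n`. -/
theorem feige_conjecture :
    ∃ Γ c : ℝ, 0 < Γ ∧ 0 < c ∧
      ∀ (k n ℓ : ℕ) (H : Finset (Finset (Fin n))),
        2 ≤ k → 2*(k-1) ≤ ℓ → ℓ ≤ n →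
        (∀ C ∈ H, C.card = k) →
        Γ^k * n * ((n:ℝ)/(ℓ:ℝ)) ^ ((k:ℝ)/2 - 1) * (Real.logb 2 n)^(4*k+1) ≤ (H.card : ℝ) →
        ∃ E : Finset (Finset (Fin n)), IsEvenCover H E ∧
          (E.card : ℝ) ≤ c * ℓ * Real.logb 2 n := by
  refine ⟨16384, 24, by norm_num, by norm_num, fun k n ℓ H hk hkl hln hcard hH => ?_⟩
  have hℓ2 : 2 ≤ ℓ := by omega
  have hℓ0 : (0 : ℝ) < ℓ := by exact_mod_cast (by omega : 0 < ℓ)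
  have hn0 : (0 : ℝ) < n := by exact_mod_cast (by omega : 0 < n)
  set lg := Real.logb 2 n with hlg
  have hlg1 : 1 ≤ lg := by
    rw [hlg, Real.le_logb_iff_rpow_le (by norm_num) hn0, Real.rpow_one]
    exact_mod_cast hℓ2.trans hln
  set q := √((n : ℝ) / ℓ) with hq
  have hq2 : q ^ 2 = (n : ℝ) / ℓ := Real.sq_sqrt (by positivity)
  have hq1 : 1 ≤ q := by
    rw [hq, Real.one_le_sqrt, one_le_div hℓ0]
    exact_mod_cast hln
  have hnq : (n : ℝ) = ℓ * q ^ 2 := by rw [hq2]; field_simp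
  have hH' : 16384 ^ k * n * q ^ (k - 2) * lg ≤ (#H : ℝ) := by
    have h1 : ((n : ℝ) / ℓ) ^ ((k : ℝ) / 2 - 1) = q ^ (k - 2) := by
      rw [← hq2, ← Real.rpow_natCast q 2, ← Real.rpow_mul (by positivity),
        ← Real.rpow_natCast q (k - 2)]
      congr 1
      push_cast [Nat.cast_sub hk]
      ring
    rw [h1] at hH
    refine le_trans ?_ hH
    gcongr
    exact le_self_pow₀ hlg1 (by omega)
  rcases lt_or_ge n (4 * ℓ) with hlarge | hsmall
  · have h1 : (n : ℝ) < #H := by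
      refine lt_of_lt_of_le ?_ hH'
      have h2 : (1 : ℝ) < 16384 ^ k := one_lt_pow₀ (by norm_num) (by omega)
      have h3 : 1 ≤ q ^ (k - 2) := one_le_pow₀ hq1
      calc (n : ℝ) = 1 * n * 1 * 1 := by ring
        _ < 16384 ^ k * n * 1 * 1 := by gcongr
        _ ≤ _ := by gcongr
    obtain ⟨E, hE, hEc⟩ := exists_isEvenCover_of_lt_card (H := H) (by exact_mod_cast h1)
    refine ⟨E, hE, ?_⟩
    have h2 : (#E : ℝ) ≤ 4 * ℓ := by exact_mod_cast (by omega : #E ≤ 4 * ℓ)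
    nlinarith
  let M : ℕ → ℕ := fun s => ⌈q ^ (k - 2 * s)⌉₊ + 1
  have hMle : ∀ s, (M s : ℝ) ≤ 3 * q ^ (k - 2 * s) := by
    intro s
    have h1 : 1 ≤ q ^ (k - 2 * s) := one_le_pow₀ hq1
    have h2 := Nat.ceil_lt_add_one (zero_le_one.trans h1)
    simp only [M]
    push_cast
    linarith
  set N : ℝ := (#H : ℝ)
  have hHpos : 0 < N := lt_of_lt_of_le (by positivity) hH'
  have hk0 : (0 : ℝ) < k := by exact_mod_cast (by omega : 0 < k)
  obtain ⟨s, hs1, hst, G, hGH, hdeg, 𝓑, hdisj, h𝓑, hW⟩ :=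
    exists_bucket_family (M := M) (fun s => Nat.succ_pos _) (W := N / (2 * k)) (k - 1) H
    (fun C hC => card_pos.1 (by rw [hcard C hC]; omega))
    (fun Q hQ => by
      refine le_trans (card_le_one.2 fun C hC C' hC' => ?_) (Nat.le_add_left 1 _)
      have h1 : ∀ C ∈ {C ∈ H | Q ⊆ C}, Q = C := fun C hC => by
        obtain ⟨hCH, hQC⟩ := mem_filter.1 hC
        exact eq_of_subset_of_card_le hQC (by rw [hcard C hCH]; omega)
      rw [← h1 C hC, ← h1 C' hC'])
    (by
      have h1 : ((k - 1 : ℕ) : ℝ) * (N / (2 * k)) ≤ N / 2 := by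
        calc ((k - 1 : ℕ) : ℝ) * (N / (2 * k)) ≤ k * (N / (2 * k)) :=
              mul_le_mul_of_nonneg_right (Nat.cast_le.2 (Nat.sub_le k 1))
                (div_nonneg hHpos.le (by positivity))
          _ = N / 2 := by field_simp
      have h2 : (n : ℝ) * M 1 ≤ 3 * (n * q ^ (k - 2)) := by
        nlinarith [mul_le_mul_of_nonneg_left (hMle 1) hn0.le]
      have h3 : 16384 * (n * q ^ (k - 2)) ≤ N := by
        refine le_trans ?_ hH'
        calc 16384 * (n * q ^ (k - 2)) = 16384 ^ 1 * n * q ^ (k - 2) * 1 := by ring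
          _ ≤ _ := by
            gcongr
            · norm_num
            · omega
      have h4 : 0 < n * q ^ (k - 2) := by positivity
      linarith)
  obtain ⟨P, R, hPsymm, hPne, hPG, hR, hvec, hRdeg, hPcard⟩ :=
    exists_pair_system (fun C hC => hcard C (hGH hC)) hdeg hdisj h𝓑
  have hPcard' : N / (2 * k) * q ^ (k - 2 * s) ≤ (#P : ℝ) := by
    rw [hPcard]
    push_cast
    exact mul_le_mul hW (Nat.le_ceil _) (by positivity) (Nat.cast_nonneg _)
  set r := 3 * ℓ * (Nat.log 2 n + 1) with hr
  have hrle : (r : ℝ) ≤ 6 * ℓ * lg := by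
    have h1 : (Nat.log 2 n : ℝ) ≤ lg := by
      have := Real.natLog_le_logb n 2
      exact_mod_cast this
    rw [hr]
    push_cast
    nlinarith
  have hdense : 256 * (r * (3 * 16 ^ (k - s))) * (4 ^ (k - s) * n ^ (k - s)) ≤
      ℓ ^ (k - s) * #P := by
    have h1 : (9216 * k * 64 ^ (k - s) : ℝ) ≤ 16384 ^ k := by
      have hk2 : (k : ℝ) ≤ 2 ^ k := by exact_mod_cast Nat.lt_two_pow_self.le
      calc (9216 * k * 64 ^ (k - s) : ℝ) ≤ 128 ^ 2 * 2 ^ k * 64 ^ k := by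
            gcongr
            · norm_num
            · norm_num
            · omega
        _ = 128 ^ 2 * 128 ^ k := by rw [mul_assoc, ← mul_pow]; norm_num
        _ ≤ 128 ^ k * 128 ^ k := by
            gcongr
            norm_num
        _ = 16384 ^ k := by rw [← mul_pow]; norm_num
    have h2 : q ^ (2 * (k - s)) ≤ q ^ k * q ^ (k - 2 * s) := by
      rw [← pow_add]
      exact pow_le_pow_right₀ hq1 (by omega)
    have h3 : 16384 ^ k * (ℓ * q ^ k) * lg ≤ N := by
      refine le_trans (le_of_eq ?_) hH'
      rw [hnq, ← Nat.add_sub_of_le hk, Nat.add_sub_cancel_left, pow_add q 2]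
      ring
    have h4 : (768 * r * 64 ^ (k - s) * q ^ (2 * (k - s)) : ℝ) ≤ #P := by
      refine le_trans ?_ hPcard'
      rw [div_mul_eq_mul_div, le_div_iff₀ (by positivity)]
      calc (768 * r * 64 ^ (k - s) * q ^ (2 * (k - s)) * (2 * k) : ℝ)
          ≤ 768 * (6 * ℓ * lg) * 64 ^ (k - s) * (q ^ k * q ^ (k - 2 * s)) * (2 * k) := by
            gcongr
        _ = (9216 * k * 64 ^ (k - s)) * (ℓ * q ^ k) * lg * q ^ (k - 2 * s) := by ring
        _ ≤ 16384 ^ k * (ℓ * q ^ k) * lg * q ^ (k - 2 * s) := by gcongr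
        _ ≤ _ := by gcongr
    have h5 : (256 * (r * (3 * 16 ^ (k - s))) * (4 ^ (k - s) * n ^ (k - s)) : ℝ) ≤
        ℓ ^ (k - s) * #P := by
      calc (256 * (r * (3 * 16 ^ (k - s))) * (4 ^ (k - s) * n ^ (k - s)) : ℝ)
          = ℓ ^ (k - s) * (768 * r * 64 ^ (k - s) * q ^ (2 * (k - s))) := by
            rw [hnq, show (64 : ℝ) = 16 * 4 by norm_num, mul_pow, mul_pow, pow_mul]
            ring
        _ ≤ _ := by gcongr
    exact_mod_cast h5
  obtain ⟨U, U', hUU', hU, hU', hsum, hUP⟩ := exists_ne_sum_indVec_eq (P := P) (R := R)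
    (b := k - s) (l := ℓ) (r := r) (K := 3 * 16 ^ (k - s)) (ρ := 4 / q ^ 2) hPsymm hPne hR hvec
    (by omega) (by omega) hsmall (by rw [hq2]; field_simp) (by positivity)
    (fun p hp a hab hba => sum_partner_weight_le hq1 hs1 hab hba hMle
      (hR p.swap (hPsymm p hp)) (hRdeg p hp))
    hdense
    (by
      calc n ^ (3 * ℓ) < (2 ^ (Nat.log 2 n + 1)) ^ (3 * ℓ) :=
            Nat.pow_lt_pow_left (Nat.lt_pow_succ_log_self (by norm_num) n) (by omega)
        _ = 2 ^ r := by rw [← pow_mul, hr, mul_comm])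
  have hUH : U ∪ U' ⊆ H := fun C hC => by
    obtain ⟨p, hp, rfl⟩ := hUP C hC
    exact hGH (hPG p hp)
  obtain ⟨E, hE, hEU⟩ := exists_isEvenCover_of_sum_eq hUH hUU' hsum
  refine ⟨E, hE, ?_⟩
  have hEc : #E ≤ 4 * r := by
    have := (card_le_card hEU).trans (card_union_le U U')
    omega
  calc (#E : ℝ) ≤ 4 * r := by exact_mod_cast hEc
    _ ≤ 4 * (6 * ℓ * lg) := by gcongr
    _ = 24 * ℓ * lg := by ring
end

section
/- There is an absolute constant C > 0 such that every simple graph G on n ≥ 2 vertices with at least n·d/2 edges, where d is a real number with d ≥ C·(log₂ n)³, contains a cycle of length at most ⌈2·log₂ n⌉. -/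
open Finset

namespace SimpleGraph

variable {V : Type*} {G : SimpleGraph V}

/-- A nonempty vertex set whose induced degrees sum to at least `2 * k * #S` contains a nonempty
subset inside which all induced degrees exceed `k`. -/
theorem exists_subset_forall_lt_card_adj [DecidableEq V] [DecidableRel G.Adj] {k : ℕ} (hk : 0 < k)
    (S : Finset V) (hS : S.Nonempty) (hsum : 2 * k * #S ≤ ∑ v ∈ S, #{w ∈ S | G.Adj v w}) :
    ∃ T ⊆ S, T.Nonempty ∧ ∀ v ∈ T, k < #{w ∈ T | G.Adj v w} := by
  induction S using Finset.strongInduction with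
  | H S ih =>
    by_cases hdeg : ∀ v ∈ S, k < #{w ∈ S | G.Adj v w}
    · exact ⟨S, Subset.rfl, hS, hdeg⟩
    push Not at hdeg
    obtain ⟨v, hv, hle⟩ := hdeg
    have hcard : #S = #(S.erase v) + 1 := (card_erase_add_one hv).symm
    have hsplit (u : V) : #{w ∈ S | G.Adj u w} =
        #{w ∈ S.erase v | G.Adj u w} + if G.Adj v u then 1 else 0 := by
      conv_lhs => rw [← insert_erase hv]
      rw [filter_insert]
      by_cases h : G.Adj u v
      · simp [h, h.symm]
      · simp [h, G.adj_comm v u]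
    have hself : #{w ∈ S.erase v | G.Adj v w} = #{w ∈ S | G.Adj v w} := by
      simp [hsplit v]
    have herase : ∑ u ∈ S, #{w ∈ S | G.Adj u w} =
        ∑ u ∈ S.erase v, #{w ∈ S.erase v | G.Adj u w} + 2 * #{w ∈ S | G.Adj v w} := by
      rw [← sum_erase_add _ _ hv, sum_congr rfl fun u _ => hsplit u, sum_add_distrib,
        ← card_filter, hself]
      ring
    have hsum' : 2 * k * #(S.erase v) ≤ ∑ u ∈ S.erase v, #{w ∈ S.erase v | G.Adj u w} := by
      rw [herase, hcard] at hsum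
      linarith
    have hne : (S.erase v).Nonempty := by
      by_contra h
      rw [not_nonempty_iff_eq_empty] at h
      rw [← hself, h] at herase
      rw [herase, hcard, h] at hsum
      simp at hsum
      omega
    obtain ⟨T, hT, h⟩ := ih _ (erase_ssubset hv) hne hsum'
    exact ⟨T, hT.trans (erase_subset _ _), h⟩

/-- In a graph without cycles of length at most `m`, a path of length less than `m` is not met
again by a neighbour of its endpoint other than the penultimate vertex. -/
theorem Walk.IsPath.notMem_support_of_adj_of_ne_penultimate {m : ℕ}
    (hG : ∀ (x : V) (c : G.Walk x x), c.IsCycle → m < c.length) {u v w : V} {p : G.Walk u v}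
    (hp : p.IsPath) (hlen : p.length < m) (hadj : G.Adj v w) (hw : w ≠ p.penultimate) :
    w ∉ p.support := by
  classical
  intro hmem
  have hne : p.dropUntil w hmem ≠ hadj.symm.toWalk := by
    intro heq
    refine hw (hp.eq_penultimate_of_mem_edges (p.edges_dropUntil_subset_edges hmem ?_))
    rw [heq]
    simp [Sym2.eq_swap]
  obtain ⟨x, -, -, c, hc, hcl⟩ :=
    (hp.dropUntil hmem).exists_isCycle_length_le_add_of_ne hadj.symm.isPath_toWalk hne
  have h1 := hG x c hc
  have h2 := p.length_dropUntil_le_length hmem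
  have h3 : hadj.symm.toWalk.length = 1 := by simp
  omega

/-- If no cycle has length at most `2 * r` and every vertex of `T` has more than `d` neighbours
in `T`, then paths of length `k ≤ r` in `T` from a fixed vertex reach at least `d ^ k` vertices. -/
theorem exists_pow_le_card_path_endpoints {r d : ℕ} {T : Finset V} [DecidableRel G.Adj]
    (hG : ∀ (x : V) (c : G.Walk x x), c.IsCycle → 2 * r < c.length)
    (hT : ∀ v ∈ T, d < #{w ∈ T | G.Adj v w}) {v : V} (hv : v ∈ T) {k : ℕ} (hk : k ≤ r) :
    ∃ A ⊆ T, d ^ k ≤ #A ∧ ∀ u ∈ A, ∃ p : G.Walk v u, p.IsPath ∧ p.length = k := by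
  classical
  induction k with
  | zero =>
    refine ⟨{v}, by simpa using hv, by simp, fun u hu => ?_⟩
    obtain rfl := mem_singleton.mp hu
    exact ⟨.nil, .nil, rfl⟩
  | succ k ih =>
    obtain ⟨A, hAT, hA, hpath⟩ := ih (by omega)
    have : Nonempty V := ⟨v⟩
    have hpen : ∀ u ∈ A, ∃ t, ∃ p : G.Walk v u, p.IsPath ∧ p.length = k ∧ p.penultimate = t :=
      fun u hu => (hpath u hu).elim fun p hp => ⟨_, p, hp.1, hp.2, rfl⟩
    choose! t ht using hpen
    let N (u : V) : Finset V := {w ∈ T | G.Adj u w}.erase (t u)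
    have hN {u w : V} (hu : u ∈ A) (hw : w ∈ N u) :
        ∃ q : G.Walk v w, q.IsPath ∧ q.length = k + 1 ∧ q.penultimate = u := by
      obtain ⟨p, hp, hlen, hpt⟩ := ht u hu
      simp only [N, mem_erase, mem_filter] at hw
      refine ⟨p.concat hw.2.2, hp.concat ?_ _, by rw [Walk.length_concat, hlen], by simp⟩
      exact hp.notMem_support_of_adj_of_ne_penultimate hG (by omega) hw.2.2 (hpt ▸ hw.1)
    have hdisj : (A : Set V).PairwiseDisjoint N := by
      intro u hu u' hu' hne
      refine Finset.disjoint_left.mpr fun w hw hw' => ?_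
      obtain ⟨q, hq, hlen, rfl⟩ := hN hu hw
      obtain ⟨q', hq', hlen', rfl⟩ := hN hu' hw'
      obtain ⟨x, -, -, c, hc, hcl⟩ :=
        hq.exists_isCycle_length_le_add_of_ne hq' fun heq => hne (by rw [heq])
      have := hG x c hc
      omega
    refine ⟨A.biUnion N, ?_, ?_, ?_⟩
    · exact biUnion_subset.mpr fun u _ => (erase_subset _ _).trans (filter_subset _ _)
    · rw [card_biUnion hdisj, pow_succ]
      refine (Nat.mul_le_mul_right d hA).trans ?_
      rw [← smul_eq_mul]
      refine card_nsmul_le_sum _ _ _ fun u hu => ?_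
      exact (Nat.le_sub_one_of_lt (hT u (hAT hu))).trans pred_card_le_card_erase
    · intro w hw
      obtain ⟨u, hu, hwu⟩ := mem_biUnion.mp hw
      obtain ⟨q, hq, hlen, -⟩ := hN hu hwu
      exact ⟨q, hq, hlen⟩

/-- A graph with at least `k * |V|` edges has a cycle of length at most `2 * r` as soon as
`|V| < k ^ r`. -/
theorem exists_isCycle_length_le_of_mul_card_le_card_edgeFinset [Fintype V] [Nonempty V]
    [DecidableRel G.Adj] {k r : ℕ} (hk : 0 < k) (hE : k * Fintype.card V ≤ #G.edgeFinset)
    (hr : Fintype.card V < k ^ r) :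
    ∃ (v : V) (c : G.Walk v v), c.IsCycle ∧ c.length ≤ 2 * r := by
  classical
  by_contra! hG
  obtain ⟨T, -, ⟨v, hv⟩, hT⟩ := exists_subset_forall_lt_card_adj (G := G) hk univ univ_nonempty (by
    have h := G.sum_degrees_eq_twice_card_edges
    simp only [← card_neighborFinset_eq_degree, neighborFinset_eq_filter] at h
    rw [h, card_univ]
    linarith)
  obtain ⟨A, -, hA, -⟩ := exists_pow_le_card_path_endpoints hG hT hv le_rfl
  exact absurd (hA.trans A.card_le_univ) (by omega)

end SimpleGraph

/-- **Weak Moore bound.** There is an absolute constant `C > 0` such that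
every simple graph `G` on `n ≥ 2` vertices with at least `n·d/2` edges, where `d` is a
real number with `d ≥ C·(log₂ n)³`, contains a cycle of length at most `⌈2·log₂ n⌉`. -/
theorem weak_moore_bound :
    ∃ C : ℝ, 0 < C ∧
      ∀ (n : ℕ) (G : SimpleGraph (Fin n)) [DecidableRel G.Adj] (d : ℝ),
        2 ≤ n →
        C * (Real.logb 2 n)^3 ≤ d →
        (n : ℝ) * d / 2 ≤ (G.edgeFinset.card : ℝ) →
        ∃ (v : Fin n) (w : G.Walk v v), w.IsCycle ∧ w.length ≤ ⌈2 * Real.logb 2 n⌉₊ := by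
  refine ⟨8, by norm_num, fun n G _ d hn hd hE => ?_⟩
  have : NeZero n := ⟨by omega⟩
  have hn' : (2 : ℝ) ≤ n := by exact_mod_cast hn
  have hlog : 1 ≤ Real.logb 2 n := by
    rw [Real.le_logb_iff_rpow_le (by norm_num) (by linarith)]
    simpa using hn'
  have hd8 : 8 ≤ d := by nlinarith [one_le_pow₀ hlog (n := 3)]
  have hE' : 4 * Fintype.card (Fin n) ≤ #G.edgeFinset := by
    rw [Fintype.card_fin]
    have : (4 * n : ℝ) ≤ #G.edgeFinset := by nlinarith
    exact_mod_cast this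
  have hr : Fintype.card (Fin n) < 4 ^ Nat.log 2 n := by
    have h1 := Nat.lt_pow_succ_log_self (b := 2) (by norm_num) n
    have h2 : 1 ≤ Nat.log 2 n := Nat.log_pos (by norm_num) hn
    rw [Fintype.card_fin, show 4 = 2 ^ 2 by norm_num, ← pow_mul]
    exact h1.trans_le (Nat.pow_le_pow_right (by norm_num) (by omega))
  obtain ⟨v, c, hc, hlen⟩ :=
    SimpleGraph.exists_isCycle_length_le_of_mul_card_le_card_edgeFinset (by norm_num) hE' hr
  refine ⟨v, c, hc, hlen.trans ?_⟩
  have hfloor : (Nat.log 2 n : ℝ) ≤ Real.logb 2 n := by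
    exact_mod_cast Real.natLog_le_logb n 2
  have : ((2 * Nat.log 2 n : ℕ) : ℝ) ≤ ⌈2 * Real.logb 2 n⌉₊ := by
    push_cast
    linarith [Nat.le_ceil (2 * Real.logb 2 n)]
  exact_mod_cast this
end

section
/- There is an absolute constant C > 0 such that the following holds. Let G be a simple graph on n ≥ 2 vertices with exactly n·d/2 edges (d ≥ 0 a real, the average degree), and let A ∈ {0,1}^{n×n} be its adjacency matrix. If G contains no cycle of length at most 2⌈log₂ n⌉, then for every y ∈ {−1,1}^n one has yᵀ A y ≤ C · n · √d · (log₂ n)^{3/2}. -/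
open Finset Matrix

namespace SimpleGraph

variable {V : Type*} {G : SimpleGraph V}

/-- If every cycle is longer than `2 * k`, paths of length at most `k` are determined by their
endpoints. -/
theorem eq_of_isPath_of_forall_isCycle_lt {k : ℕ}
    (hG : ∀ (v : V) (w : G.Walk v v), w.IsCycle → 2 * k < w.length)
    {u v : V} {p q : G.Walk u v} (hp : p.IsPath) (hq : q.IsPath)
    (hpk : p.length ≤ k) (hqk : q.length ≤ k) : p = q := by
  classical
  set H : SimpleGraph V := fromEdgeSet {e | e ∈ p.edges ∨ e ∈ q.edges} with hH
  have mem_H {e : Sym2 V} (he : e ∈ p.edges ∨ e ∈ q.edges) : e ∈ H.edgeSet := by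
    rw [hH, edgeSet_fromEdgeSet]
    exact ⟨he, fun hd => G.not_isDiag_of_mem_edgeSet
      (he.elim (fun h => p.edges_subset_edgeSet h)
        (fun h => q.edges_subset_edgeSet h)) hd⟩
  have hHG : H ≤ G := by
    rw [← edgeSet_subset_edgeSet, hH, edgeSet_fromEdgeSet]
    exact fun e he => he.1.elim (fun h => p.edges_subset_edgeSet h)
      (fun h => q.edges_subset_edgeSet h)
  have hac : H.IsAcyclic := by
    intro x c hc
    have h1 := hG x (c.mapLe hHG) (hc.mapLe hHG)
    rw [Walk.length_map] at h1
    have h2 : c.edges ⊆ p.edges ++ q.edges := by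
      intro e he
      have := c.edges_subset_edgeSet he
      rw [hH, edgeSet_fromEdgeSet] at this
      exact List.mem_append.2 this.1
    have h3 := (List.subperm_of_subset hc.edges_nodup h2).length_le
    simp only [List.length_append, Walk.length_edges] at h3
    omega
  have key := (hac.subsingleton_path u v).elim
    ⟨p.transfer H fun e he => mem_H (.inl he), hp.transfer _⟩
    ⟨q.transfer H fun e he => mem_H (.inr he), hq.transfer _⟩
  have h := congrArg (fun r : H.Walk u v => r.support) (Subtype.ext_iff.1 key)
  simp only [Walk.support_transfer] at h
  exact Walk.ext_support h

variable [DecidableRel G.Adj]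

/-- If all cycles are longer than `2 * k` and every vertex of `S` has more than `m` neighbours
in `S`, then `S` has at least `m ^ k` elements. -/
theorem pow_le_card_of_forall_isCycle_lt {k m : ℕ}
    (hG : ∀ (v : V) (w : G.Walk v v), w.IsCycle → 2 * k < w.length)
    {S : Finset V} (hS : S.Nonempty) (hdeg : ∀ v ∈ S, m < #{w ∈ S | G.Adj v w}) :
    m ^ k ≤ #S := by
  classical
  obtain ⟨v, hv⟩ := hS
  let T (j : ℕ) : Finset V := {u ∈ S | ∃ p : G.Walk v u, p.IsPath ∧ p.length = j}
  suffices h : ∀ j ≤ k, m ^ j ≤ #(T j) from (h k le_rfl).trans (card_le_card (filter_subset _ _))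
  intro j
  induction j with
  | zero =>
    intro _
    rw [pow_zero, Nat.one_le_iff_ne_zero, ← Nat.pos_iff_ne_zero, card_pos]
    exact ⟨v, mem_filter.2 ⟨hv, .nil, .nil, rfl⟩⟩
  | succ j ih =>
    intro hj
    rw [pow_succ]
    refine (Nat.mul_le_mul_right m (ih (by omega))).trans ?_
    rw [← mul_one #(T (j + 1))]
    refine card_mul_le_card_mul G.Adj (fun a ha => ?_) (fun b hb => ?_)
    · obtain ⟨haS, p, hp, hpj⟩ := mem_filter.1 ha
      have hsub : {w ∈ S | G.Adj a w}.erase p.penultimate ⊆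
          (T (j + 1)).bipartiteAbove G.Adj a := by
        intro b hb
        obtain ⟨hbp, hb⟩ := mem_erase.1 hb
        obtain ⟨hbS, hab⟩ := mem_filter.1 hb
        refine mem_filter.2 ⟨mem_filter.2 ⟨hbS, p.concat hab, hp.concat ?_ hab, by simp [hpj]⟩, hab⟩
        intro hbp'
        have hlen := p.length_dropUntil_le_length hbp'
        have h := eq_of_isPath_of_forall_isCycle_lt hG (hp.dropUntil hbp')
          (Walk.IsPath.of_adj hab.symm) (by omega) (by simp; omega)
        have hpen : p.penultimate = b := by
          conv_lhs => rw [← p.take_spec hbp', h]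
          rw [Adj.toWalk, ← Walk.concat_eq_append, Walk.penultimate_concat]
        exact hbp hpen.symm
      have h1 := card_le_card hsub
      have h2 := pred_card_le_card_erase (s := {w ∈ S | G.Adj a w}) (a := p.penultimate)
      have h3 := hdeg a haS
      omega
    · obtain ⟨hbS, q, hq, hqj⟩ := mem_filter.1 hb
      refine card_le_one.2 fun a ha a' ha' => ?_
      have hpen {a : V} (ha : a ∈ (T j).bipartiteBelow G.Adj b) : q.penultimate = a := by
        obtain ⟨ha, hab⟩ := mem_filter.1 ha
        obtain ⟨-, p, hp, hpj⟩ := mem_filter.1 ha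
        have hbp : b ∉ p.support := by
          intro hbp
          have hlen := p.length_takeUntil_le_length hbp
          have h := eq_of_isPath_of_forall_isCycle_lt hG (hp.takeUntil hbp) hq
            (by omega) (by omega)
          rw [h] at hlen
          omega
        rw [eq_of_isPath_of_forall_isCycle_lt hG hq (hp.concat hbp hab) (by omega)
          (by simp; omega), Walk.penultimate_concat]
      rw [← hpen ha, ← hpen ha']

/-- A graph in which every nonempty vertex set `S` has a vertex with at most `m` neighbours in `S`
has at most `m * #S` edges inside any `S`. -/
theorem sum_card_filter_adj_le {m : ℕ}
    (h : ∀ S : Finset V, S.Nonempty → ∃ v ∈ S, #{w ∈ S | G.Adj v w} ≤ m) (S : Finset V) :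
    ∑ v ∈ S, #{w ∈ S | G.Adj v w} ≤ 2 * m * #S := by
  classical
  induction hn : #S generalizing S with
  | zero => simp [card_eq_zero.1 hn]
  | succ n ih =>
    obtain ⟨v, hv, hvm⟩ := h S (card_pos.1 (by omega))
    have ih' := ih (S.erase v) (by rw [card_erase_of_mem hv]; omega)
    simp only [card_filter] at hvm ih' ⊢
    simp only [← add_sum_erase S _ hv, sum_add_distrib, G.irrefl, G.adj_comm _ v,
      if_false, zero_add] at hvm ih' ⊢
    linarith

/-- A graph on `n ≥ 2` vertices without cycles of length at most `2 * ⌈log₂ n⌉` has at most `3 * n`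
edges. -/
theorem card_edgeFinset_le_of_forall_isCycle_lt [Fintype V] (hn : 2 ≤ Fintype.card V)
    (hG : ∀ (v : V) (w : G.Walk v v), w.IsCycle →
      2 * ⌈Real.logb 2 (Fintype.card V)⌉₊ < w.length) :
    #G.edgeFinset ≤ 3 * Fintype.card V := by
  classical
  have h : ∀ S : Finset V, S.Nonempty → ∃ v ∈ S, #{w ∈ S | G.Adj v w} ≤ 3 := by
    intro S hS
    by_contra! hdeg
    have h1 := (pow_le_card_of_forall_isCycle_lt hG hS hdeg).trans (card_le_univ S)
    have h2 : Fintype.card V ≤ 2 ^ ⌈Real.logb 2 (Fintype.card V)⌉₊ := by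
      have h3 := (Real.logb_le_iff_le_rpow one_lt_two (by positivity)).1
        (Nat.le_ceil (Real.logb 2 (Fintype.card V)))
      rw [Real.rpow_natCast] at h3
      exact_mod_cast h3
    have h3 : ⌈Real.logb 2 (Fintype.card V)⌉₊ ≠ 0 := fun h0 => by
      rw [h0] at h2
      omega
    have h4 := Nat.pow_lt_pow_left (show 2 < 3 by norm_num) h3
    omega
  have h1 := sum_card_filter_adj_le h univ
  have h2 := G.sum_degrees_eq_twice_card_edges
  simp only [← card_neighborFinset_eq_degree, neighborFinset_eq_filter] at h2
  rw [h2, card_univ] at h1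
  omega

/-- The quadratic form of the adjacency matrix on sign vectors is at most twice the number of
edges. -/
theorem dotProduct_adjMatrix_mulVec_le [Fintype V] {y : V → ℝ} (hy : ∀ i, y i = 1 ∨ y i = -1) :
    y ⬝ᵥ (G.adjMatrix ℝ *ᵥ y) ≤ 2 * #G.edgeFinset := by
  have h2 : ((∑ v, G.degree v : ℕ) : ℝ) = 2 * #G.edgeFinset := by
    rw [G.sum_degrees_eq_twice_card_edges]
    push_cast
    rfl
  rw [← h2, dotProduct]
  push_cast
  refine sum_le_sum fun i _ => ?_
  rw [adjMatrix_mulVec_apply, mul_sum, ← card_neighborFinset_eq_degree, card_eq_sum_ones]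
  push_cast
  refine sum_le_sum fun j _ => ?_
  rcases hy i with h | h <;> rcases hy j with h' | h' <;> rw [h, h'] <;> norm_num

end SimpleGraph

/-- There is an absolute constant `C > 0` such that for any simple graph `G`
on `n ≥ 2` vertices with exactly `n·d/2` edges (`d ≥ 0` real, the average degree) and
adjacency matrix `A`, if `G` contains no cycle of length at most `2⌈log₂ n⌉`, then for every
`y ∈ {−1,1}^n` one has `yᵀ A y ≤ C · n · √d · (log₂ n)^{3/2}`. -/
theorem trace_method_no_even_covers_graphs :
    ∃ C : ℝ, 0 < C ∧
      ∀ (n : ℕ) (G : SimpleGraph (Fin n)) [DecidableRel G.Adj] (d : ℝ),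
        2 ≤ n →
        0 ≤ d →
        (G.edgeFinset.card : ℝ) = (n : ℝ) * d / 2 →
        (∀ (v : Fin n) (w : G.Walk v v), w.IsCycle → 2 * ⌈Real.logb 2 n⌉₊ < w.length) →
        ∀ y : Fin n → ℝ, (∀ i, y i = 1 ∨ y i = -1) →
          y ⬝ᵥ ((G.adjMatrix ℝ) *ᵥ y) ≤ C * n * Real.sqrt d * (Real.logb 2 n) ^ ((3:ℝ)/2) := by
  refine ⟨3, by norm_num, fun n G _ d hn hd hE hG y hy => ?_⟩
  have hn' : (2 : ℝ) ≤ n := by exact_mod_cast hn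
  have hE' : (#G.edgeFinset : ℝ) ≤ 3 * n := by
    have := G.card_edgeFinset_le_of_forall_isCycle_lt (by simpa using hn) (by simpa using hG)
    rw [Fintype.card_fin] at this
    exact_mod_cast this
  have hd6 : d ≤ 6 := by
    by_contra! h
    nlinarith
  have hsqrt : √d ≤ 3 := Real.sqrt_le_iff.2 ⟨by norm_num, by linarith⟩
  have hlog : 1 ≤ Real.logb 2 n ^ ((3 : ℝ) / 2) := by
    refine Real.one_le_rpow ?_ (by norm_num)
    rw [Real.le_logb_iff_rpow_le one_lt_two (by linarith)]
    simpa using hn'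
  calc y ⬝ᵥ (G.adjMatrix ℝ *ᵥ y) ≤ 2 * #G.edgeFinset := G.dotProduct_adjMatrix_mulVec_le hy
    _ = n * (√d * √d) := by rw [hE, Real.mul_self_sqrt hd]; ring
    _ ≤ n * (3 * √d) := by gcongr
    _ = 3 * n * √d * 1 := by ring
    _ ≤ 3 * n * √d * Real.logb 2 n ^ ((3 : ℝ) / 2) := by gcongr
end

section
/- There exist absolute constants C > 0 and c > 0 such that for all integers n, ℓ with 6 ≤ ℓ ≤ n, every 4-uniform hypergraph on [n] with at least C·(n²/ℓ)·(log₂ n)³ hyperedges contains an even cover of length at most c·ℓ·log₂ n. -/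
open Finset

open scoped symmDiff

/-- A finite set on which a symmetric relation has average degree at least `2 * d` contains a
nonempty subset on which it has minimum degree at least `d`. -/
theorem exists_subset_le_degree {α : Type*} [DecidableEq α] (r : α → α → Prop)
    [DecidableRel r] (hr : ∀ a b, r a b → r b a) (d : ℕ) (U : Finset α) (hU : U.Nonempty)
    (h : 2 * d * #U ≤ ∑ a ∈ U, #(U.filter (r a))) :
    ∃ W ⊆ U, W.Nonempty ∧ ∀ a ∈ W, d ≤ #(W.filter (r a)) := by
  induction U using Finset.strongInduction with
  | H U ih =>
  by_cases hd : ∀ a ∈ U, d ≤ #(U.filter (r a))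
  · exact ⟨U, Subset.rfl, hU, hd⟩
  push Not at hd
  obtain ⟨a, ha, had⟩ := hd
  have hsplit : ∑ b ∈ U, #(U.filter (r b)) =
      #(U.filter (r a)) + ∑ b ∈ U.erase a, #(U.filter (r b)) := (add_sum_erase _ _ ha).symm
  have hdeg : ∀ b ∈ U.erase a,
      #(U.filter (r b)) = #((U.erase a).filter (r b)) + if r b a then 1 else 0 := by
    intro b _
    rw [filter_erase]
    split_ifs with hba
    · rw [card_erase_add_one (by simp [ha, hba])]
    · rw [erase_eq_of_notMem (by simp [hba]), add_zero]
  have hback : ∑ b ∈ U.erase a, (if r b a then 1 else 0) ≤ #(U.filter (r a)) := by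
    rw [← card_filter]
    refine card_le_card fun b hb => ?_
    simp only [mem_filter, mem_erase] at hb ⊢
    exact ⟨hb.1.2, hr _ _ hb.2⟩
  rw [sum_congr rfl hdeg, sum_add_distrib] at hsplit
  have hcard := card_erase_add_one ha
  have hne : (U.erase a).Nonempty := by
    rw [nonempty_iff_ne_empty]
    intro he
    rw [he] at hsplit hcard
    simp only [sum_empty, card_empty] at hsplit hcard
    rw [← hcard] at h
    omega
  obtain ⟨W, hW, hW'⟩ := ih _ (erase_ssubset ha) hne (by rw [← hcard] at h; linarith)
  exact ⟨W, hW.trans (erase_subset _ _), hW'⟩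

section OddSupport

variable {V : Type*} [Fintype V] [DecidableEq V]

/-- The set of vertices lying in an odd number of members of `A`, that is, the symmetric
difference of all the members of `A`. -/
def oddSupport (A : Finset (Finset V)) : Finset V :=
  univ.filter fun v => Odd #(A.filter (v ∈ ·))

theorem oddSupport_insert {A : Finset (Finset V)} {C : Finset V} (hC : C ∉ A) :
    oddSupport (insert C A) = oddSupport A ∆ C := by
  ext v
  simp only [oddSupport, mem_filter, mem_univ, true_and, mem_symmDiff, filter_insert]
  split_ifs with hv
  · rw [card_insert_of_notMem (by simp [hC]), Nat.odd_add_one]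
    simp [hv]
  · simp [hv]

theorem even_card_filter_symmDiff {A B : Finset (Finset V)}
    (h : oddSupport A = oddSupport B) (v : V) :
    Even #((A ∆ B).filter (v ∈ ·)) := by
  have hv : Odd #(A.filter (v ∈ ·)) ↔ Odd #(B.filter (v ∈ ·)) := by
    simpa [oddSupport] using congrArg (v ∈ ·) h
  have hsd : (A ∆ B).filter (v ∈ ·) =
      (A.filter (v ∈ ·) \ B.filter (v ∈ ·)) ∪ (B.filter (v ∈ ·) \ A.filter (v ∈ ·)) := by
    ext C
    simp only [mem_filter, mem_symmDiff, mem_union, mem_sdiff]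
    tauto
  rw [hsd, card_union_of_disjoint
    (disjoint_of_subset_right sdiff_subset disjoint_sdiff_self_left)]
  have h₁ := card_sdiff_add_card_inter (A.filter (v ∈ ·)) (B.filter (v ∈ ·))
  have h₂ := card_sdiff_add_card_inter (B.filter (v ∈ ·)) (A.filter (v ∈ ·))
  rw [inter_comm] at h₂
  grind

/-- If every vertex of a set `W` of vertices of the Cayley graph generated by `H` has at least
`3 * r` neighbours in `W`, then at least `2 ^ i` subfamilies of `H` of size `i ≤ r` lead from a
given vertex of `W` back into `W`. -/
theorem two_pow_le_card_walks (H : Finset (Finset V)) (W : Finset (Finset V)) (r : ℕ)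
    (hW : ∀ S ∈ W, 3 * r ≤ #(W.filter (fun T => S ∆ T ∈ H))) {S : Finset V} (hS : S ∈ W) :
    ∀ i ≤ r, 2 ^ i ≤ #((H.powersetCard i).filter (fun A => S ∆ oddSupport A ∈ W)) := by
  intro i
  induction i with
  | zero =>
    intro _
    have hempty : S ∆ oddSupport (∅ : Finset (Finset V)) = S := by
      rw [show oddSupport (∅ : Finset (Finset V)) = ⊥ by simp [oddSupport], symmDiff_bot]
    simp [filter_singleton, hempty, hS]
  | succ i ih =>
    intro hi
    have key := card_mul_le_card_mul (fun A B : Finset (Finset V) => A ⊆ B)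
      (s := (H.powersetCard i).filter (fun A => S ∆ oddSupport A ∈ W))
      (t := (H.powersetCard (i + 1)).filter (fun A => S ∆ oddSupport A ∈ W))
      (m := 2 * (i + 1)) (n := i + 1) ?_ ?_
    · have := ih (by omega)
      rw [← mul_assoc] at key
      have := Nat.le_of_mul_le_mul_right key (by omega)
      rw [pow_succ]
      omega
    · intro A hA
      simp only [mem_filter, mem_powersetCard] at hA
      obtain ⟨⟨hAH, hAi⟩, hAW⟩ := hA
      set T₀ := S ∆ oddSupport A with hT₀
      have hcard : 2 * (i + 1) ≤ #((W.filter (fun T => T₀ ∆ T ∈ H)).filter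
          (fun T => T₀ ∆ T ∉ A)) := by
        have h₁ := hW T₀ hAW
        have h₂ := card_filter_add_card_filter_not (s := W.filter (fun T => T₀ ∆ T ∈ H))
          (fun T => T₀ ∆ T ∈ A)
        have h₃ : #((W.filter (fun T => T₀ ∆ T ∈ H)).filter (fun T => T₀ ∆ T ∈ A)) ≤ #A :=
          card_le_card_of_injOn (fun T => T₀ ∆ T) (by intro T hT; simp_all)
            (fun T _ T' _ h => symmDiff_right_injective T₀ h)
        omega
      refine hcard.trans (card_le_card_of_injOn (fun T => insert (T₀ ∆ T) A) ?_ ?_)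
      · intro T hT
        simp only [coe_filter, mem_filter, Set.mem_ofPred_eq] at hT
        obtain ⟨⟨hTW, hTH⟩, hTA⟩ := hT
        simp only [bipartiteAbove, coe_filter, mem_filter, mem_powersetCard, Set.mem_ofPred_eq]
        refine ⟨⟨⟨insert_subset hTH hAH, by rw [card_insert_of_notMem hTA, hAi]⟩, ?_⟩,
          subset_insert _ _⟩
        rw [oddSupport_insert hTA, ← symmDiff_assoc, ← hT₀, symmDiff_symmDiff_cancel_left]
        exact hTW
      · intro T hT T' hT' h
        simp only [coe_filter, mem_filter, Set.mem_ofPred_eq] at hT hT'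
        have hmem : T₀ ∆ T ∈ insert (T₀ ∆ T') A := by
          rw [← show insert (T₀ ∆ T) A = insert (T₀ ∆ T') A from h]
          exact mem_insert_self _ _
        exact symmDiff_right_injective T₀ ((mem_insert.1 hmem).resolve_right hT.2)
    · intro B hB
      simp only [mem_filter, mem_powersetCard] at hB
      have hsub : ((H.powersetCard i).filter (fun A => S ∆ oddSupport A ∈ W)).bipartiteBelow
          (fun A B : Finset (Finset V) => A ⊆ B) B ⊆ B.powersetCard i := by
        intro A hA
        simp only [bipartiteBelow, mem_filter, mem_powersetCard] at hA ⊢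
        exact ⟨hA.2, hA.1.1.2⟩
      refine (card_le_card hsub).trans ?_
      rw [card_powersetCard, hB.1.2, Nat.choose_succ_self_right]

/-- A set of fewer than `2 ^ r` vertices on which the Cayley graph generated by `H` has average
degree at least `6 * r` yields a nontrivial relation of length at most `2 * r` in `H`. -/
theorem exists_even_cover_of_average_degree (H : Finset (Finset V)) (U : Finset (Finset V))
    (r : ℕ) (hU : U.Nonempty) (hr : #U < 2 ^ r)
    (h : 6 * r * #U ≤ ∑ S ∈ U, #(U.filter (fun T => S ∆ T ∈ H))) :
    ∃ E ⊆ H, E.Nonempty ∧ (∀ v, Even #(E.filter (v ∈ ·))) ∧ #E ≤ 2 * r := by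
  obtain ⟨W, hWU, ⟨S, hS⟩, hW⟩ := exists_subset_le_degree
    (fun S T : Finset V => S ∆ T ∈ H) (fun S T h => by rwa [symmDiff_comm]) (3 * r) U hU
    (by linarith)
  have hwalks := two_pow_le_card_walks H W r hW hS r le_rfl
  obtain ⟨A, hA, B, hB, hAB, hEq⟩ := exists_ne_map_eq_of_card_lt_of_maps_to
    (((card_le_card hWU).trans_lt hr).trans_le hwalks)
    (f := fun A => S ∆ oddSupport A) (fun A hA => (mem_filter.1 hA).2)
  simp only [mem_filter, mem_powersetCard] at hA hB
  refine ⟨A ∆ B, ?_, ?_, even_card_filter_symmDiff (symmDiff_right_injective S hEq), ?_⟩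
  · exact symmDiff_subset_union.trans (union_subset hA.1.1 hB.1.1)
  · rwa [nonempty_iff_ne_empty, ← bot_eq_empty, Ne, symmDiff_eq_bot]
  · have := (card_le_card (symmDiff_subset_union (s := A) (t := B))).trans (card_union_le A B)
    omega

/-- A lower bound on the number of `k`-sets whose symmetric difference with a `4`-set is a `k`-set. -/
theorem choose_le_card_filter_symmDiff {C : Finset V} (hC : #C = 4) {k : ℕ} (hk : 2 ≤ k) :
    (Fintype.card V - 4).choose (k - 2) ≤
      #((univ.powersetCard k).filter (fun S => #(S ∆ C) = k)) := by
  obtain ⟨P, hPC, hP⟩ := exists_subset_card_eq (show 2 ≤ #C by omega)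
  rw [← hC, ← card_compl, ← card_powersetCard]
  refine card_le_card_of_injOn (fun Q => P ∪ Q) ?_ ?_
  · intro Q hQ
    simp only [mem_coe, mem_powersetCard] at hQ
    have hQC : Disjoint C Q := (disjoint_compl_right).mono_right hQ.1
    have hsd : (P ∪ Q) ∆ C = (C \ P) ∪ Q := by
      ext v
      have hv₁ : v ∈ P → v ∈ C := fun hv => hPC hv
      have hv₂ : v ∈ C → v ∉ Q := fun hv => disjoint_left.1 hQC hv
      simp only [mem_symmDiff, mem_union, mem_sdiff]
      tauto
    simp only [coe_filter, mem_powersetCard, Set.mem_ofPred_eq, subset_univ, true_and]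
    rw [hsd, card_union_of_disjoint (hQC.mono_left hPC),
      card_union_of_disjoint (hQC.mono_left sdiff_subset), card_sdiff_of_subset hPC]
    omega
  · intro Q hQ Q' hQ' h
    simp only [mem_coe, mem_powersetCard] at hQ hQ'
    have hdisj : ∀ R ⊆ Cᶜ, (P ∪ R) \ P = R := fun R hR =>
      union_sdiff_cancel_left (disjoint_compl_right.mono hPC hR)
    rw [← hdisj Q hQ.1, ← hdisj Q' hQ'.1]
    exact congrArg (· \ P) h

theorem card_mul_choose_le_sum_degree (H : Finset (Finset V)) (hH : ∀ C ∈ H, #C = 4) {k : ℕ}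
    (hk : 2 ≤ k) :
    #H * (Fintype.card V - 4).choose (k - 2) ≤
      ∑ S ∈ (univ : Finset V).powersetCard k,
        #(((univ : Finset V).powersetCard k).filter (fun T => S ∆ T ∈ H)) := by
  calc #H * (Fintype.card V - 4).choose (k - 2)
      ≤ ∑ C ∈ H, #((univ.powersetCard k).filter (fun S => #(S ∆ C) = k)) := by
        rw [← smul_eq_mul]
        exact card_nsmul_le_sum _ _ _ fun C hC => choose_le_card_filter_symmDiff (hH C hC) hk
    _ = ∑ S ∈ (univ : Finset V).powersetCard k, #(H.filter (fun C => #(S ∆ C) = k)) :=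
        (sum_card_bipartiteAbove_eq_sum_card_bipartiteBelow _).symm
    _ ≤ _ := by
        refine sum_le_sum fun S _ => card_le_card_of_injOn (fun C => S ∆ C) ?_
          (fun C _ C' _ h => symmDiff_right_injective S h)
        intro C hC
        simp only [coe_filter, Set.mem_ofPred_eq] at hC
        simp [hC]

end OddSupport

theorem add_four_choose_mul (a b : ℕ) :
    (a + b + 4).choose (a + 2) * ((a + 2) * (a + 1) * ((b + 2) * (b + 1))) =
      (a + b + 4) * (a + b + 3) * (a + b + 2) * (a + b + 1) * (a + b).choose a := by
  have h₁ := Nat.add_choose_mul_factorial_mul_factorial (b + 2) (a + 2)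
  have h₂ := Nat.add_choose_mul_factorial_mul_factorial b a
  rw [show b + 2 + (a + 2) = a + b + 4 by ring] at h₁
  rw [add_comm b a] at h₂
  simp only [Nat.factorial_succ] at h₁
  rw [← h₂] at h₁
  have hpos : 0 < a.factorial * b.factorial := by positivity
  apply Nat.eq_of_mul_eq_mul_right hpos
  linear_combination h₁

theorem sq_mul_choose_le {n k : ℕ} (hk : 2 ≤ k) (hkn : 2 * k ≤ n) :
    k ^ 2 * n.choose k ≤ 8 * n ^ 2 * (n - 4).choose (k - 2) := by
  obtain ⟨a, rfl⟩ := Nat.exists_eq_add_of_le' hk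
  obtain ⟨c, rfl⟩ := Nat.exists_eq_add_of_le' hkn
  have h := add_four_choose_mul a (a + c)
  rw [show c + 2 * (a + 2) - 4 = a + (a + c) by omega, Nat.add_sub_cancel,
    show c + 2 * (a + 2) = a + (a + c) + 4 by ring]
  set X := (a + (a + c) + 4).choose (a + 2)
  set Y := (a + (a + c)).choose a
  set n := a + (a + c) + 4 with hn
  have hpos : 0 < n * (n - 2) := by
    have : 0 < n - 2 := by omega
    positivity
  refine Nat.le_of_mul_le_mul_right ?_ hpos
  rw [show n - 2 = a + (a + c) + 2 by omega]
  calc (a + 2) ^ 2 * X * (n * (a + (a + c) + 2))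
      = X * ((a + 2) * (a + 2) * (n * (a + (a + c) + 2))) := by ring
    _ ≤ X * ((a + 2) * (2 * (a + 1)) * ((2 * (a + c + 2)) * (2 * (a + c + 1)))) := by
        gcongr <;> omega
    _ = 8 * (n * (a + (a + c) + 3) * (a + (a + c) + 2) * (a + (a + c) + 1) * Y) := by
        rw [← h]; ring
    _ ≤ 8 * (n * n * (a + (a + c) + 2) * n * Y) := by gcongr <;> omega
    _ = 8 * n ^ 2 * Y * (n * (a + (a + c) + 2)) := by ring

/-- **Feige's conjecture, 4-uniform case.** There exist absolute constants
`C > 0` and `c > 0` such that for all integers `n, ℓ` with `6 ≤ ℓ ≤ n`, every 4-uniform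
hypergraph on `[n]` with at least `C·(n²/ℓ)·(log₂ n)³` hyperedges contains an even cover
of length at most `c·ℓ·log₂ n`. -/
theorem feige_conjecture_four_uniform :
    ∃ C c : ℝ, 0 < C ∧ 0 < c ∧
      ∀ (n ℓ : ℕ) (H : Finset (Finset (Fin n))),
        6 ≤ ℓ → ℓ ≤ n →
        (∀ Ce ∈ H, Ce.card = 4) →
        C * ((n:ℝ)^2/(ℓ:ℝ)) * (Real.logb 2 n)^3 ≤ (H.card : ℝ) →
        ∃ E : Finset (Finset (Fin n)), IsEvenCover H E ∧
          (E.card : ℝ) ≤ c * ℓ * Real.logb 2 n := by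
  refine ⟨288, 2, by norm_num, by norm_num, ?_⟩
  intro n ℓ H hℓ hℓn hH hm
  obtain ⟨k, hk⟩ : ∃ k, k = ℓ / 2 := ⟨_, rfl⟩
  set L := Real.logb 2 n with hL
  have hlog : (Nat.log 2 n : ℝ) ≤ L := by
    simpa using Real.natLog_le_logb n 2
  have hL1 : 1 ≤ L := by
    refine le_trans ?_ hlog
    exact_mod_cast Nat.log_pos one_lt_two (by omega)
  have hdense : 48 * n ^ 2 * (Nat.log 2 n + 1) ≤ #H * k := by
    have hℓpos : (0 : ℝ) < ℓ := by exact_mod_cast (by omega : 0 < ℓ)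
    have hℓk : (ℓ : ℝ) ≤ 3 * k := by exact_mod_cast (by omega : ℓ ≤ 3 * k)
    have hL3 : L ≤ L ^ 3 := le_self_pow₀ hL1 (by norm_num)
    have hstep : 288 * (n : ℝ) ^ 2 * L ≤ #H * ℓ := by
      calc 288 * (n : ℝ) ^ 2 * L ≤ 288 * (n : ℝ) ^ 2 * L ^ 3 := by gcongr
        _ = 288 * ((n : ℝ) ^ 2 / ℓ) * L ^ 3 * ℓ := by field_simp
        _ ≤ #H * ℓ := by gcongr
    have hreal : 48 * (n : ℝ) ^ 2 * (Nat.log 2 n + 1) ≤ #H * k := by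
      have h₁ : 48 * (n : ℝ) ^ 2 * (Nat.log 2 n + 1) ≤ 48 * (n : ℝ) ^ 2 * (2 * L) := by
        gcongr
        linarith
      have h₂ : (#H : ℝ) * ℓ ≤ #H * (3 * k) := by gcongr
      linarith
    exact_mod_cast hreal
  have hN : #((univ : Finset (Fin n)).powersetCard k) = n.choose k := by simp
  have hchoose : n.choose k < 2 ^ (k * (Nat.log 2 n + 1)) := by
    rw [mul_comm, pow_mul]
    exact (Nat.choose_le_pow n k).trans_lt
      (Nat.pow_lt_pow_left (Nat.lt_pow_succ_log_self one_lt_two n) (by omega))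
  obtain ⟨E, hEH, hE, heven, hcard⟩ := exists_even_cover_of_average_degree H
    (univ.powersetCard k) (k * (Nat.log 2 n + 1))
    (powersetCard_nonempty.2 (by simp; omega)) (by rwa [hN]) (by
      refine le_trans ?_ (card_mul_choose_le_sum_degree H hH (by omega))
      rw [hN, Fintype.card_fin]
      have hsq := sq_mul_choose_le (n := n) (k := k) (by omega) (by omega)
      have hkpos : 0 < k := by omega
      refine Nat.le_of_mul_le_mul_right ?_ hkpos
      calc 6 * (k * (Nat.log 2 n + 1)) * n.choose k * k
          = 6 * (Nat.log 2 n + 1) * (k ^ 2 * n.choose k) := by ring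
        _ ≤ 6 * (Nat.log 2 n + 1) * (8 * n ^ 2 * (n - 4).choose (k - 2)) := by gcongr
        _ = 48 * n ^ 2 * (Nat.log 2 n + 1) * (n - 4).choose (k - 2) := by ring
        _ ≤ #H * k * (n - 4).choose (k - 2) := by gcongr
        _ = #H * (n - 4).choose (k - 2) * k := by ring)
  refine ⟨E, ⟨hEH, hE, fun v => heven v⟩, ?_⟩
  have hkℓ : 2 * (k : ℝ) ≤ ℓ := by exact_mod_cast (by omega : 2 * k ≤ ℓ)
  calc (#E : ℝ) ≤ 2 * (k * (Nat.log 2 n + 1)) := by exact_mod_cast hcard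
    _ = 2 * k * (Nat.log 2 n + 1) := by ring
    _ ≤ ℓ * (2 * L) := by gcongr; linarith
    _ = 2 * ℓ * L := by ring
end

section
/- Let k ≥ 2, let H be a k-uniform multi-hypergraph on [n] with m hyperedges (counted with multiplicity), let ε ∈ (0,1] and let ℓ be an integer with 1 ≤ ℓ ≤ n. Then there exists a bipartite contraction of H consisting of a sub-multiset H^(1) ⊆ H of discarded hyperedges and, for each t = 2,…,k, a p^(t)-bipartite t-uniform hypergraph {H^(t)_u}_{u∈[p^(t)]} together with a set Q_u ⊆ [n] of size k+1−t for each u ∈ [p^(t)], such that: (i) for every t, u and R ∈ H^(t)_u, the sets Q_u and R are disjoint and Q_u ∪ R is a hyperedge of H; (ii) every element of the multiset H is used exactly once, i.e., each C ∈ H either lies in H^(1) or equals Q_u ∪ R for exactly one choice of t, u ∈ [p^(t)] and R ∈ H^(t)_u; (iii) |H^(1)| ≤ (n/(k·ε²))·(n/ℓ)^{k/2 − 1}; (iv) for each t ≥ 2, the bipartite hypergraph {H^(t)_u}_u is (ε,ℓ)-regular and |H^(t)_u| = ⌊(1/ε²)·max((n/ℓ)^{t − k/2 − 1}, 1)⌋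 for every u ∈ [p^(t)]. -/
open Finset
open scoped Classical

/-- A finite set can be greedily partitioned into labelled good blocks, with a remainder that
contains no good block. -/
theorem exists_maximal_block_packing {ι β : Type*} [Fintype ι] [Inhabited β]
    (Good : ℕ → β → Finset ι → Prop) (hne : ∀ t b B, Good t b B → B.Nonempty)
    (S : Finset ι) :
    ∃ (p : ℕ → ℕ) (Q : ℕ → ℕ → β) (asgn : ι → Option (ℕ × ℕ)),
      (∀ j t u, asgn j = some (t, u) → j ∈ S ∧ u < p t) ∧
      (∀ t u, u < p t → Good t (Q t u) (univ.filter (fun j => asgn j = some (t, u)))) ∧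
      (∀ t b B, (∀ j ∈ B, j ∈ S ∧ asgn j = none) → ¬ Good t b B) := by
  induction S using Finset.strongInduction with
  | H S ih =>
    by_cases h : ∃ t b B, B ⊆ S ∧ Good t b B
    · obtain ⟨t, b, B, hBS, hB⟩ := h
      obtain ⟨p, Q, asgn, h1, h2, h3⟩ := ih (S \ B) (sdiff_ssubset hBS (hne _ _ _ hB))
      have hnot : ∀ j ∈ B, asgn j = none := by
        intro j hj
        rcases hx : asgn j with _ | ⟨s, u⟩
        · rfl
        · exact absurd hj (mem_sdiff.1 (h1 j s u hx).1).2
      refine ⟨Function.update p t (p t + 1), Function.update Q t (Function.update (Q t) (p t) b),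
        fun j => if j ∈ B then some (t, p t) else asgn j, ?_, ?_, ?_⟩
      · intro j s u hj
        dsimp only at hj
        split_ifs at hj with hjB
        · simp only [Option.some.injEq, Prod.mk.injEq] at hj
          obtain ⟨rfl, rfl⟩ := hj
          exact ⟨hBS hjB, by simp⟩
        · obtain ⟨h4, h5⟩ := h1 j s u hj
          refine ⟨(mem_sdiff.1 h4).1, ?_⟩
          by_cases hst : s = t
          · subst hst; simp; omega
          · simpa [hst] using h5
      · intro s u hu
        by_cases hnew : s = t ∧ u = p t
        · obtain ⟨rfl, rfl⟩ := hnew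
          have : univ.filter (fun j => (if j ∈ B then some (s, p s) else asgn j)
              = some (s, p s)) = B := by
            ext j
            simp only [mem_filter, mem_univ, true_and]
            constructor
            · intro hj
              by_contra hjB
              rw [if_neg hjB] at hj
              exact absurd (h1 j _ _ hj).2 (lt_irrefl _)
            · intro hj; simp [hj]
          rw [this]
          simpa using hB
        · have hu' : u < p s := by
            by_cases hst : s = t
            · subst hst; simp at hu hnew; omega
            · simpa [hst] using hu
          have hQ : Function.update Q t (Function.update (Q t) (p t) b) s u = Q s u := by
            by_cases hst : s = t
            · subst hst
              have : u ≠ p s := by simpa using hnew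
              simp [this]
            · simp [hst]
          have : univ.filter (fun j => (if j ∈ B then some (t, p t) else asgn j)
              = some (s, u)) = univ.filter (fun j => asgn j = some (s, u)) := by
            ext j
            simp only [mem_filter, mem_univ, true_and]
            by_cases hj : j ∈ B
            · simp only [hj, if_true, hnot j hj, Option.some.injEq, Prod.mk.injEq, reduceCtorEq,
                iff_false]
              rintro ⟨rfl, rfl⟩
              exact hnew ⟨rfl, rfl⟩
            · simp [hj]
          rw [hQ, this]
          exact h2 s u hu'
      · intro s c C hC
        refine h3 s c C fun j hj => ?_
        obtain ⟨h4, h5⟩ := hC j hj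
        dsimp only at h5
        split_ifs at h5 with hjB
        exact ⟨mem_sdiff.2 ⟨h4, hjB⟩, h5⟩
    · refine ⟨fun _ => 0, fun _ _ => default, fun _ => none, by simp, by simp, ?_⟩
      intro t b B hB hG
      exact h ⟨t, b, B, fun j hj => (hB j hj).1, hG⟩

/-- A block of hyperedges of the family `H` that share the common part `Q` of size `k + 1 - t`,
has exactly `τ t` members, and has degree at most `τ s` on sets of size `k + 1 - s` for each
`2 ≤ s ≤ t`. -/
structure IsContractionBlock {ι α : Type*} (k : ℕ) (τ : ℕ → ℕ) (H : ι → Finset α)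
    (t : ℕ) (Q : Finset α) (B : Finset ι) : Prop where
  two_le : 2 ≤ t
  le_k : t ≤ k
  card_common : Q.card = k + 1 - t
  common_subset : ∀ j ∈ B, Q ⊆ H j
  card_block : B.card = τ t
  degree_le : ∀ s (A : Finset α), 2 ≤ s → s ≤ t → A.card = k + 1 - s →
    (B.filter (fun j => A ⊆ H j)).card ≤ τ s

/-- If some set of size `k + 1 - t` has degree at least `τ t`, then a contraction block exists:
take the smallest such `t`. -/
theorem exists_isContractionBlock {ι α : Type*} {k : ℕ} {τ : ℕ → ℕ} {H : ι → Finset α}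
    {S : Finset ι} {t : ℕ} {A : Finset α} (ht : 2 ≤ t) (htk : t ≤ k) (hA : A.card = k + 1 - t)
    (hdeg : τ t ≤ (S.filter (fun j => A ⊆ H j)).card) :
    ∃ s Q B, B ⊆ S ∧ IsContractionBlock k τ H s Q B := by
  have hex : ∃ s, 2 ≤ s ∧ s ≤ k ∧ ∃ Q : Finset α, Q.card = k + 1 - s ∧
      τ s ≤ (S.filter (fun j => Q ⊆ H j)).card := ⟨t, ht, htk, A, hA, hdeg⟩
  obtain ⟨hs2, hsk, Q, hQ, hQdeg⟩ := Nat.find_spec hex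
  have hmin := fun {r} => Nat.find_min (H := hex) (m := r)
  generalize Nat.find hex = s at hs2 hsk hQ hQdeg hmin
  obtain ⟨B, hBS, hB⟩ := exists_subset_card_eq hQdeg
  refine ⟨s, Q, B, hBS.trans (filter_subset _ _), hs2, hsk, hQ,
    fun j hj => (mem_filter.1 (hBS hj)).2, hB, ?_⟩
  intro r A hr2 hrs hA
  rcases hrs.eq_or_lt with rfl | hlt
  · exact (card_filter_le _ _).trans hB.le
  · by_contra! hcon
    refine hmin hlt ⟨hr2, hrs.trans hsk, A, hA, hcon.le.trans (card_le_card ?_)⟩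
    exact filter_subset_filter _ (hBS.trans (filter_subset _ _))

/-- The degree of a set of size at most `t - 1` in the contraction of a block is bounded by one
of the thresholds. -/
theorem IsContractionBlock.card_filter_subset_sdiff_le {ι α : Type*} {k : ℕ} {τ : ℕ → ℕ}
    {H : ι → Finset α} {t : ℕ} {Q : Finset α} {B : Finset ι}
    (h : IsContractionBlock k τ H t Q B) (Q' : Finset α) :
    (B.filter (fun j => Q' ⊆ H j \ Q)).card ≤ τ (max 2 (t - Q'.card)) := by
  have h2 := h.two_le
  have hk := h.le_k
  by_cases hd : Disjoint Q Q'
  · have hc := card_union_of_disjoint hd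
    rw [h.card_common] at hc
    obtain ⟨A, hAs, hA⟩ := exists_subset_card_eq
      (show k + 1 - max 2 (t - Q'.card) ≤ (Q ∪ Q').card by omega)
    refine le_trans (card_le_card ?_) (h.degree_le _ A (by omega) (by omega) hA)
    intro j hj
    obtain ⟨hjB, hj⟩ := mem_filter.1 hj
    exact mem_filter.2 ⟨hjB, hAs.trans
      (union_subset (h.common_subset j hjB) (hj.trans sdiff_subset))⟩
  · have : B.filter (fun j => Q' ⊆ H j \ Q) = ∅ := by
      refine filter_eq_empty_iff.2 fun j _ hj => hd ?_
      exact (disjoint_of_subset_left hj sdiff_disjoint).symm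
    simp [this]

/-- Double counting: a `k`-uniform family on `α` whose vertices have degree at most `d` has at
most `|α| * d / k` members. -/
theorem card_mul_le_of_degree_le {ι α : Type*} [Fintype α] {k d : ℕ} {H : ι → Finset α}
    (hH : ∀ j, (H j).card = k) {S : Finset ι}
    (hd : ∀ x, (S.filter (fun j => {x} ⊆ H j)).card ≤ d) : S.card * k ≤ Fintype.card α * d := by
  have := sum_card_bipartiteAbove_eq_sum_card_bipartiteBelow (s := S)
    (t := (univ : Finset α)) (fun j x => x ∈ H j)
  simp only [bipartiteAbove, bipartiteBelow, filter_univ_mem, hH, sum_const, smul_eq_mul] at this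
  rw [this]
  calc _ ≤ ∑ _x : α, d := sum_le_sum fun x _ => by simpa using hd x
    _ = Fintype.card α * d := by simp

/-- **Hypergraph decomposition / bipartite contraction lemma.**
Let `k ≥ 2` and let `H` be a `k`-uniform multi-hypergraph on `[n]` with `m` hyperedges,
given as an indexed family `H : Fin m → Finset (Fin n)` (distinct indices encode
distinct multiset elements). Let `ε ∈ (0,1]` and `1 ≤ ℓ ≤ n`. Then there is a bipartite
contraction of `H`: numbers of partitions `p t` for each `t = 2,…,k`, sets `Q t u` of
size `k+1−t` for each `u < p t`, and an assignment sending each hyperedge index either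
to `none` (discarded, i.e. placed in `H^(1)`) or to a unique pair `(t, u)` — placing the
contracted hyperedge `(Q t u, H j \ Q t u)` into the `t`-uniform bipartite hypergraph's
partition `u` — such that:
(i) whenever `asgn j = some (t,u)` we have `2 ≤ t ≤ k`, `u < p t`, `Q t u ⊆ H j`
and `|Q t u| = k+1−t` (hence `Q t u` and `R := H j \ Q t u` are disjoint with
`Q t u ∪ R = H j` a hyperedge of `H`);
(ii) every hyperedge is used exactly once (automatic, since `asgn` is a function);
(iii) the number of discarded hyperedges is at most `(n/(kε²))·(n/ℓ)^{k/2−1}`;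
(iv)(a) each resulting bipartite `t`-uniform hypergraph is `(ε,ℓ)`-regular, and
(iv)(b) each of its partitions has exactly `⌊(1/ε²)·max((n/ℓ)^{t−k/2−1},1)⌋` hyperedges. -/
theorem hypergraph_decomposition
    (k n m ℓ : ℕ) (hk : 2 ≤ k) (hℓ1 : 1 ≤ ℓ) (hℓn : ℓ ≤ n)
    (H : Fin m → Finset (Fin n)) (hH : ∀ j, (H j).card = k)
    (ε : ℝ) (hε : 0 < ε) (hε1 : ε ≤ 1) :
    ∃ (p : ℕ → ℕ) (Q : ℕ → ℕ → Finset (Fin n)) (asgn : Fin m → Option (ℕ × ℕ)),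
      -- (i) structural conditions on contractions
      (∀ j t u, asgn j = some (t, u) →
        2 ≤ t ∧ t ≤ k ∧ u < p t ∧ Q t u ⊆ H j ∧ (Q t u).card = k + 1 - t) ∧
      -- (iii) bound on the discarded hyperedges H^(1)
      (((Finset.univ.filter (fun j => asgn j = none)).card : ℝ)
        ≤ ((n:ℝ) / ((k:ℝ) * ε^2)) * ((n:ℝ)/(ℓ:ℝ)) ^ ((k:ℝ)/2 - 1)) ∧
      -- (iv)(a) each bipartite t-uniform hypergraph is (ε,ℓ)-regular
      (∀ t, 2 ≤ t → t ≤ k → ∀ u, u < p t →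
        ∀ Q' : Finset (Fin n), Q'.card ≤ t - 1 →
          ((Finset.univ.filter (fun j =>
              asgn j = some (t, u) ∧ Q' ⊆ H j \ Q t u)).card : ℝ)
            ≤ (1/ε^2) * max (((n:ℝ)/(ℓ:ℝ)) ^ ((t:ℝ)/2 - 1 - (Q'.card:ℝ))) 1) ∧
      -- (iv)(b) all partitions of the t-uniform bipartite hypergraph have equal size
      (∀ t, 2 ≤ t → t ≤ k → ∀ u, u < p t →
        (Finset.univ.filter (fun j => asgn j = some (t, u))).card
          = ⌊(1/ε^2) * max (((n:ℝ)/(ℓ:ℝ)) ^ ((t:ℝ) - (k:ℝ)/2 - 1)) 1⌋₊) := by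
  have hr : (1 : ℝ) ≤ (n : ℝ) / ℓ := by
    rw [one_le_div (by exact_mod_cast hℓ1)]
    exact_mod_cast hℓn
  generalize (n : ℝ) / ℓ = r at hr ⊢
  have hε2 : (1 : ℝ) ≤ 1 / ε ^ 2 := by
    rw [one_le_div (by positivity)]
    exact pow_le_one₀ hε.le hε1
  obtain ⟨τ, hτ⟩ : ∃ τ : ℕ → ℕ,
      ∀ t, τ t = ⌊(1/ε^2) * max (r ^ ((t:ℝ) - (k:ℝ)/2 - 1)) 1⌋₊ := ⟨_, fun _ => rfl⟩
  simp_rw [← hτ]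
  have hτle : ∀ t, (τ t : ℝ) ≤ (1/ε^2) * max (r ^ ((t:ℝ) - (k:ℝ)/2 - 1)) 1 :=
    fun t => hτ t ▸ Nat.floor_le (by positivity)
  have hτpos : ∀ t, 0 < τ t := fun t => hτ t ▸
    Nat.floor_pos.2 (one_le_mul_of_one_le_of_one_le hε2 (le_max_right _ _))
  have hk2 : (2 : ℝ) ≤ k := by exact_mod_cast hk
  obtain ⟨p, Q, asgn, h1, h2, h3⟩ := exists_maximal_block_packing
    (IsContractionBlock k τ H)
    (fun t b B hB => card_pos.1 (hB.card_block ▸ hτpos t)) univ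
  refine ⟨p, Q, asgn, ?_, ?_, ?_, fun t _ _ u hu => (h2 t u hu).card_block⟩
  · intro j t u hj
    have hu := (h1 j t u hj).2
    have hB := h2 t u hu
    exact ⟨hB.two_le, hB.le_k, hu, hB.common_subset j (by simpa using hj), hB.card_common⟩
  · have hcount : (univ.filter (fun j => asgn j = none)).card * k ≤ Fintype.card (Fin n) * τ k := by
      refine card_mul_le_of_degree_le hH fun x => ?_
      by_contra! hx
      obtain ⟨s, A, B, hBS, hB⟩ :=
        exists_isContractionBlock (A := {x}) hk le_rfl (by simp) hx.le
      exact h3 s A B (fun j hj => by simpa using hBS hj) hB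
    rw [Fintype.card_fin] at hcount
    have hτk : (τ k : ℝ) ≤ (1/ε^2) * r ^ ((k:ℝ)/2 - 1) := by
      refine (hτle k).trans_eq ?_
      rw [show (k:ℝ) - (k:ℝ)/2 - 1 = (k:ℝ)/2 - 1 by ring,
        max_eq_left (Real.one_le_rpow hr (by linarith))]
    have hkpos : (0 : ℝ) < k := by linarith
    calc _ ≤ (n : ℝ) * τ k / k := (le_div_iff₀ hkpos).2 (by exact_mod_cast hcount)
      _ ≤ n * ((1/ε^2) * r ^ ((k:ℝ)/2 - 1)) / k := by gcongr
      _ = _ := by field_simp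
  · intro t _ htk u hu Q' _
    have hle := (h2 t u hu).card_filter_subset_sdiff_le Q'
    rw [filter_filter] at hle
    refine le_trans (Nat.cast_le.2 ?_) ((hτle (max 2 (t - Q'.card))).trans ?_)
    · convert hle
    gcongr (1/ε^2) * ?_
    have htk' : (t : ℝ) ≤ k := by exact_mod_cast htk
    refine max_le ?_ (le_max_right _ _)
    rcases le_total 2 (t - Q'.card) with hq | hq
    · rw [max_eq_right hq, Nat.cast_sub (by omega)]
      exact (Real.rpow_le_rpow_of_exponent_le hr (by linarith)).trans (le_max_left _ _)
    · rw [max_eq_left hq]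
      refine (Real.rpow_le_one_of_one_le_of_nonpos hr ?_).trans (le_max_right _ _)
      push_cast
      linarith
end

section
/- Let {H_u}_{u∈[p]} be a p-bipartite k-uniform hypergraph on [n] with m = Σ_u |H_u| hyperedges, let b_{u,C} ∈ [−1,1] for every u and C ∈ H_u, let ψ(y,x) = (1/m) Σ_{u∈[p]} y_u Σ_{C∈H_u} b_{u,C} x_C, and let f(x) = (p/m²) Σ_{u∈[p]} Σ_{(C,C') ordered pairs of distinct elements of H_u} b_{u,C} b_{u,C'} x_C x_{C'}. If ε > 0 and p ≤ ε² m, then val(ψ)² ≤ val(f) + ε². -/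
open Finset
open scoped Classical

/-- Cauchy–Schwarz after grouping the terms of a signed sum by the fibres of `π`. -/
lemma sq_sum_sign_mul_le {ι κ : Type*} [Fintype ι] [Fintype κ] (π : ι → κ)
    (y : κ → ℝ) (hy : ∀ u, y u = 1 ∨ y u = -1) (a : ι → ℝ) :
    (∑ j, y (π j) * a j) ^ 2 ≤
      Fintype.card κ * ∑ j, ∑ j', if π j = π j' then a j * a j' else 0 := by
  have hfib : ∑ j, y (π j) * a j = ∑ u, y u * ∑ j, if π j = u then a j else 0 := by
    simp_rw [Finset.mul_sum]
    rw [Finset.sum_comm]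
    simp
  have hsq : ∀ u, (y u * ∑ j, if π j = u then a j else 0) ^ 2 =
      ∑ j, ∑ j', if π j = u then (if π j' = u then a j * a j' else 0) else 0 := by
    intro u
    have hyu : y u ^ 2 = 1 := by rcases hy u with h | h <;> simp [h]
    rw [mul_pow, hyu, one_mul, sq, Finset.sum_mul_sum]
    refine Finset.sum_congr rfl fun j _ => Finset.sum_congr rfl fun j' _ => ?_
    split_ifs <;> simp
  calc (∑ j, y (π j) * a j) ^ 2
      ≤ Fintype.card κ * ∑ u, (y u * ∑ j, if π j = u then a j else 0) ^ 2 := by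
        rw [hfib]
        exact sq_sum_le_card_mul_sum_sq
    _ = _ := by
        simp_rw [hsq]
        rw [Finset.sum_comm]
        congr 1
        refine Finset.sum_congr rfl fun j _ => ?_
        rw [Finset.sum_comm]
        refine Finset.sum_congr rfl fun j' _ => ?_
        simp [eq_comm]

/-- Splitting off the diagonal of the fibrewise quadratic form. -/
lemma sum_fiber_mul_le {ι κ : Type*} [Fintype ι] (π : ι → κ) (a : ι → ℝ)
    (ha : ∀ j, |a j| ≤ 1) :
    ∑ j, ∑ j', (if π j = π j' then a j * a j' else 0) ≤
      (∑ j, ∑ j', if j ≠ j' ∧ π j = π j' then a j * a j' else 0) + Fintype.card ι := by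
  have hsplit : ∀ j, ∑ j', (if π j = π j' then a j * a j' else 0) =
      (∑ j', if j ≠ j' ∧ π j = π j' then a j * a j' else 0) + a j ^ 2 := by
    intro j
    have hdiag : a j ^ 2 = ∑ j', if j = j' then a j * a j' else 0 := by simp [sq]
    rw [hdiag, ← Finset.sum_add_distrib]
    refine Finset.sum_congr rfl fun j' _ => ?_
    by_cases h : j = j' <;> simp [h]
  have hcard : ∑ j, a j ^ 2 ≤ (Fintype.card ι : ℝ) := by
    calc ∑ j, a j ^ 2 ≤ ∑ _j : ι, (1 : ℝ) :=
          Finset.sum_le_sum fun j _ => (sq_le_one_iff_abs_le_one _).2 (ha j)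
      _ = _ := by simp
  simp_rw [hsplit, Finset.sum_add_distrib]
  gcongr

lemma abs_prod_sign {ι : Type*} (s : Finset ι) (x : ι → ℝ)
    (hx : ∀ i, x i = 1 ∨ x i = -1) : |∏ i ∈ s, x i| = 1 := by
  rw [Finset.abs_prod]
  exact Finset.prod_eq_one fun i _ => by rcases hx i with h | h <;> simp [h]

lemma finite_setOf_sign (ι : Type*) [Finite ι] :
    {x : ι → ℝ | ∀ i, x i = 1 ∨ x i = -1}.Finite := by
  have h : (Set.univ.pi fun _ : ι => ({1, -1} : Set ℝ)).Finite :=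
    Set.Finite.pi fun _ => Set.toFinite _
  exact h.subset fun x hx i _ => hx i

/-- **Cauchy–Schwarz trick.** Let `{H_u}_{u∈[p]}` be a `p`-bipartite
`k`-uniform hypergraph on `[n]`, given by an indexed family of `m` hyperedges: the
`j`-th hyperedge lies in partition `π j ∈ [p]` and has `(k−1)`-element set `Ed j ⊆ [n]`
(this representation encodes multisets `H_u`, with distinct indices playing the role of
distinct multiset elements). Let `b_j ∈ [−1,1]`, let
`ψ(y,x) = (1/m) Σ_j y_{π j} b_j x_{Ed j}` and
`f(x) = (p/m²) Σ_{j ≠ j', π j = π j'} b_j b_{j'} x_{Ed j} x_{Ed j'}`.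
If `ε > 0` and `p ≤ ε² m`, then `val(ψ)² ≤ val(f) + ε²`, where `val` denotes the
maximum over `±1` assignments (expressed via `sSup`). -/
theorem cauchy_schwarz_trick
    (k n p m : ℕ) (hk : 2 ≤ k)
    (π : Fin m → Fin p) (Ed : Fin m → Finset (Fin n))
    (hEd : ∀ j, (Ed j).card = k - 1)
    (b : Fin m → ℝ) (hb : ∀ j, |b j| ≤ 1)
    (ε : ℝ) (hε : 0 < ε) (hpm : (p:ℝ) ≤ ε^2 * m) :
    (sSup {r : ℝ | ∃ (y : Fin p → ℝ) (x : Fin n → ℝ),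
        (∀ u, y u = 1 ∨ y u = -1) ∧ (∀ i, x i = 1 ∨ x i = -1) ∧
        r = (1/(m:ℝ)) * ∑ j, y (π j) * b j * ∏ i ∈ Ed j, x i})^2
    ≤ sSup {r : ℝ | ∃ x : Fin n → ℝ, (∀ i, x i = 1 ∨ x i = -1) ∧
        r = ((p:ℝ)/(m:ℝ)^2) * ∑ j, ∑ j',
          if j ≠ j' ∧ π j = π j' then
            b j * b j' * (∏ i ∈ Ed j, x i) * (∏ i ∈ Ed j', x i)
          else 0} + ε^2 := by
  have hpw : ∀ (y : Fin p → ℝ) (x : Fin n → ℝ),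
      (∀ u, y u = 1 ∨ y u = -1) → (∀ i, x i = 1 ∨ x i = -1) →
      ((1 / (m : ℝ)) * ∑ j, y (π j) * b j * ∏ i ∈ Ed j, x i) ^ 2 ≤
        ((p : ℝ) / (m : ℝ) ^ 2) * (∑ j, ∑ j',
          if j ≠ j' ∧ π j = π j' then
            b j * b j' * (∏ i ∈ Ed j, x i) * (∏ i ∈ Ed j', x i)
          else 0) + ε ^ 2 := by
    intro y x hy hx
    have hcs := sq_sum_sign_mul_le π y hy fun j => b j * ∏ i ∈ Ed j, x i
    have hdiag := sum_fiber_mul_le π (fun j => b j * ∏ i ∈ Ed j, x i) fun j => by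
      rw [abs_mul, abs_prod_sign _ x hx, mul_one]
      exact hb j
    simp only [Fintype.card_fin, ← mul_assoc, mul_right_comm _ (∏ i ∈ Ed _, x i) (b _)]
      at hcs hdiag
    have hm : (p : ℝ) / (m : ℝ) ^ 2 * m ≤ ε ^ 2 := by
      rcases Nat.eq_zero_or_pos m with rfl | hm
      · simp [sq_nonneg]
      · have hm' : (0 : ℝ) < m := by exact_mod_cast hm
        rw [div_mul_eq_mul_div, div_le_iff₀ (by positivity)]
        nlinarith
    have hsq := hcs.trans (mul_le_mul_of_nonneg_left hdiag (Nat.cast_nonneg p))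
    generalize (∑ j, ∑ j', if j ≠ j' ∧ π j = π j' then
      b j * b j' * (∏ i ∈ Ed j, x i) * (∏ i ∈ Ed j', x i) else 0) = F at hsq ⊢
    calc _ = (1 / (m : ℝ) ^ 2) * (∑ j, y (π j) * b j * ∏ i ∈ Ed j, x i) ^ 2 := by ring
      _ ≤ (1 / (m : ℝ) ^ 2) * (p * (F + m)) := by gcongr
      _ = (p : ℝ) / (m : ℝ) ^ 2 * F + (p : ℝ) / (m : ℝ) ^ 2 * m := by ring
      _ ≤ _ := by gcongr
  set T := {r : ℝ | ∃ x : Fin n → ℝ, (∀ i, x i = 1 ∨ x i = -1) ∧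
    r = ((p : ℝ) / (m : ℝ) ^ 2) * ∑ j, ∑ j',
      if j ≠ j' ∧ π j = π j' then
        b j * b j' * (∏ i ∈ Ed j, x i) * (∏ i ∈ Ed j', x i)
      else 0}
  have hTbdd : BddAbove T := by
    refine (((finite_setOf_sign (Fin n)).image fun x => ((p : ℝ) / (m : ℝ) ^ 2) * ∑ j, ∑ j',
      if j ≠ j' ∧ π j = π j' then
        b j * b j' * (∏ i ∈ Ed j, x i) * (∏ i ∈ Ed j', x i)
      else 0).subset ?_).bddAbove
    rintro r ⟨x, hx, rfl⟩
    exact ⟨x, hx, rfl⟩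
  set S := {r : ℝ | ∃ (y : Fin p → ℝ) (x : Fin n → ℝ),
    (∀ u, y u = 1 ∨ y u = -1) ∧ (∀ i, x i = 1 ∨ x i = -1) ∧
    r = (1 / (m : ℝ)) * ∑ j, y (π j) * b j * ∏ i ∈ Ed j, x i}
  have hSsq : ∀ r ∈ S, r ^ 2 ≤ sSup T + ε ^ 2 := by
    rintro r ⟨y, x, hy, hx, rfl⟩
    exact (hpw y x hy hx).trans (by gcongr; exact le_csSup hTbdd ⟨x, hx, rfl⟩)
  have hSfin : S.Finite := by
    refine (((finite_setOf_sign (Fin p)).prod (finite_setOf_sign (Fin n))).image fun q =>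
      (1 / (m : ℝ)) * ∑ j, q.1 (π j) * b j * ∏ i ∈ Ed j, q.2 i).subset ?_
    rintro r ⟨y, x, hy, hx, rfl⟩
    exact ⟨(y, x), ⟨hy, hx⟩, rfl⟩
  have hSne : S.Nonempty :=
    ⟨_, fun _ => 1, fun _ => 1, fun _ => .inl rfl, fun _ => .inl rfl, rfl⟩
  exact hSsq _ (hSne.csSup_mem hSfin)
end

section
/- Let k ≥ 2, let ℓ, n be integers with 2(k−1) ≤ ℓ ≤ n, let {H_u}_{u∈[p]} be a p-bipartite k-uniform hypergraph on [n] with m hyperedges, let b_{u,C} ∈ [−1,1], and let f(x) = (p/m²) Σ_{u∈[p]} Σ_{(C,C') ordered pairs of distinct elements of H_u} b_{u,C} b_{u,C'} x_C x_{C'}. Let A be the level-ℓ Kikuchi matrix and D the associated constant. For x ∈ {−1,1}^n let x^{⋆ℓ} ∈ {−1,1}^N be the vector whose entry at an ℓ-subset S of [n]×{1,2} is ∏_{(i,b)∈S} x_i. Then for every x ∈ {−1,1}^n, (x^{⋆ℓ})ᵀ A x^{⋆ℓ} = (m² D / p) · f(x); consequently max_{x ∈ {−1,1}^n} f(x) ≤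 (p/(m² D)) · ‖A‖_{∞→1}. -/
open Finset
open scoped Classical

/-- The first clone `C^(1) = C × {1}` of a set `C ⊆ [n]`, inside `[n] × {1,2}`. -/
def clone1 {n : ℕ} (C : Finset (Fin n)) : Finset (Fin n × Fin 2) :=
  C.image (fun i => (i, 0))

/-- The second clone `C^(2) = C × {2}` of a set `C ⊆ [n]`, inside `[n] × {1,2}`. -/
def clone2 {n : ℕ} (C : Finset (Fin n)) : Finset (Fin n × Fin 2) :=
  C.image (fun i => (i, 1))

/-- The relation `S ↔_{C,C'} T` defining the nonzero entries of the Kikuchi matrix: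
`S ⊕ T = C^(1) ⊕ C'^(2)` together with the appropriate intersection-size conditions,
depending on the parity of `k`. -/
def KikRel (k : ℕ) {n : ℕ} (C C' : Finset (Fin n))
    (S T : Finset (Fin n × Fin 2)) : Prop :=
  (S \ T) ∪ (T \ S) = (clone1 C \ clone2 C') ∪ (clone2 C' \ clone1 C) ∧
  ((Odd k ∧
      (S ∩ clone1 C).card = (k-1)/2 ∧ (S ∩ clone2 C').card = (k-1)/2 ∧
      (T ∩ clone1 C).card = (k-1)/2 ∧ (T ∩ clone2 C').card = (k-1)/2) ∨
   (Even k ∧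
      (((S ∩ clone1 C).card = k/2 ∧ (T ∩ clone2 C').card = k/2 ∧
        (S ∩ clone2 C').card = (k-2)/2 ∧ (T ∩ clone1 C).card = (k-2)/2) ∨
       ((S ∩ clone1 C).card = (k-2)/2 ∧ (T ∩ clone2 C').card = (k-2)/2 ∧
        (S ∩ clone2 C').card = k/2 ∧ (T ∩ clone1 C).card = k/2))))

/-- The Kikuchi constant `D`. -/
def kikD (k n ℓ : ℕ) : ℕ :=
  if Odd k then
    ((k-1).choose ((k-1)/2))^2 * ((2*n - 2*(k-1)).choose (ℓ - (k-1)))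
  else
    2 * ((k-1).choose (k/2)) * ((k-1).choose ((k-2)/2)) * ((2*n - 2*(k-1)).choose (ℓ - (k-1)))

/-- The level-`ℓ` Kikuchi matrix `A = Σ_u A_u` of the `p`-bipartite `k`-uniform
hypergraph whose `j`-th hyperedge lies in partition `π j` and has `(k−1)`-element set
`Ed j`, with coefficients `b j` (distinct indices `j` encode distinct multiset
elements). Its entry at `(S,T)` is `Σ b_j · b_{j'}` over ordered pairs of distinct
hyperedge indices `j ≠ j'` in a common partition with `S ↔_{Ed j, Ed j'} T`. -/
noncomputable def kikA (k n p m : ℕ) (π : Fin m → Fin p) (Ed : Fin m → Finset (Fin n))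
    (b : Fin m → ℝ) (S T : Finset (Fin n × Fin 2)) : ℝ :=
  ∑ j : Fin m, ∑ j' : Fin m,
    if j ≠ j' ∧ π j = π j' ∧ KikRel k (Ed j) (Ed j') S T then b j * b j' else 0

/-- The collection of all `ℓ`-element subsets of `[n] × {1,2}`. -/
def ellSubsets (n ℓ : ℕ) : Finset (Finset (Fin n × Fin 2)) :=
  Finset.univ.filter (fun S => S.card = ℓ)

/-- The number of `ℓ`-subsets meeting two disjoint sets in prescribed cardinalities. -/
theorem card_filter_card_inter_eq {α : Type*} [Fintype α] [DecidableEq α] {P Q : Finset α}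
    (hPQ : Disjoint P Q) (a c r : ℕ) :
    #{S : Finset α | S.card = a + c + r ∧ (S ∩ P).card = a ∧ (S ∩ Q).card = c}
      = P.card.choose a * Q.card.choose c
          * (Fintype.card α - (P.card + Q.card)).choose r := by
  rw [← card_union_of_disjoint hPQ, ← card_compl, ← card_powersetCard, ← card_powersetCard,
    ← card_powersetCard, ← card_product, ← card_product]
  refine card_nbij' (fun S => ((S ∩ P, S ∩ Q), S ∩ (P ∪ Q)ᶜ)) (fun t => t.1.1 ∪ t.1.2 ∪ t.2)
    ?_ ?_ ?_ ?_
  · intro S hS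
    simp only [coe_filter, mem_univ, true_and, Set.mem_ofPred_eq] at hS
    obtain ⟨h, hP, hQ⟩ := hS
    have h1 : (S ∩ (P ∪ Q)).card = a + c := by
      rw [inter_union_distrib_left, card_union_of_disjoint, hP, hQ]
      exact hPQ.mono inter_subset_right inter_subset_right
    have h2 := card_inter_add_card_sdiff S (P ∪ Q)
    rw [sdiff_eq_inter_compl] at h2
    simp only [mem_coe, mem_product, mem_powersetCard]
    exact ⟨⟨⟨inter_subset_right, hP⟩, inter_subset_right, hQ⟩, inter_subset_right, by omega⟩
  · rintro ⟨⟨A, B⟩, R⟩ h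
    simp only [mem_coe, mem_product, mem_powersetCard] at h
    obtain ⟨⟨⟨hA, rfl⟩, hB, rfl⟩, hR, rfl⟩ := h
    have hAB : Disjoint A B := hPQ.mono hA hB
    have hABR : Disjoint (A ∪ B) R :=
      (disjoint_compl_right (a := P ∪ Q)).mono (union_subset_union hA hB) hR
    simp only [coe_filter, mem_univ, true_and, Set.mem_ofPred_eq]
    refine ⟨by rw [card_union_of_disjoint hABR, card_union_of_disjoint hAB], ?_, ?_⟩ <;>
    · congr 1
      ext e
      have h1 := @hA e
      have h2 := @hB e
      have h3 := @hR e
      have h4 : e ∈ P → e ∉ Q := fun h => disjoint_left.mp hPQ h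
      simp only [mem_inter, mem_union, mem_compl] at *
      tauto
  · intro S _
    ext e
    simp only [mem_inter, mem_union, mem_compl]
    tauto
  · rintro ⟨⟨A, B⟩, R⟩ h
    simp only [mem_coe, mem_product, mem_powersetCard] at h
    obtain ⟨⟨⟨hA, -⟩, hB, -⟩, hR, -⟩ := h
    simp only [Prod.mk.injEq]
    refine ⟨⟨?_, ?_⟩, ?_⟩ <;>
    · ext e
      have h1 := @hA e
      have h2 := @hB e
      have h3 := @hR e
      have h4 : e ∈ P → e ∉ Q := fun h => disjoint_left.mp hPQ h
      simp only [mem_inter, mem_union, mem_compl] at *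
      tauto

theorem prod_mul_prod_eq_prod_symmDiff {α : Type*} [DecidableEq α] {y : α → ℝ}
    (hy : ∀ e, y e = 1 ∨ y e = -1) (S T : Finset α) :
    (∏ e ∈ S, y e) * ∏ e ∈ T, y e = ∏ e ∈ (S \ T) ∪ (T \ S), y e := by
  have hsq : (∏ e ∈ S ∩ T, y e) * ∏ e ∈ S ∩ T, y e = 1 := by
    rw [← prod_mul_distrib]
    refine prod_eq_one fun e _ => ?_
    rcases hy e with h | h <;> simp [h]
  rw [← prod_inter_mul_prod_sdiff S T, ← prod_inter_mul_prod_sdiff T S, inter_comm T S,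
    prod_union (disjoint_sdiff_sdiff)]
  linear_combination (∏ e ∈ S \ T, y e) * (∏ e ∈ T \ S, y e) * hsq

theorem prod_eq_one_or_neg_one {α : Type*} {y : α → ℝ} (hy : ∀ e, y e = 1 ∨ y e = -1)
    (S : Finset α) : ∏ e ∈ S, y e = 1 ∨ ∏ e ∈ S, y e = -1 :=
  prod_induction y (fun r => r = 1 ∨ r = -1)
    (by rintro _ _ (rfl | rfl) (rfl | rfl) <;> norm_num) (Or.inl rfl) fun e _ => hy e

theorem disjoint_clone1_clone2 {n : ℕ} (C C' : Finset (Fin n)) :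
    Disjoint (clone1 C) (clone2 C') := by
  rw [disjoint_left]
  rintro ⟨i, c⟩ h h'
  simp only [clone1, clone2, mem_image, Prod.mk.injEq] at h h'
  obtain ⟨_, -, -, rfl⟩ := h
  obtain ⟨_, -, -, h⟩ := h'
  exact absurd h (by decide)

theorem card_clone1 {n : ℕ} (C : Finset (Fin n)) : (clone1 C).card = C.card :=
  card_image_of_injective _ (Prod.mk_left_injective 0)

theorem card_clone2 {n : ℕ} (C : Finset (Fin n)) : (clone2 C).card = C.card :=
  card_image_of_injective _ (Prod.mk_left_injective 1)

/-- The condition that `KikRel` imposes on the row index alone. -/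
def KikSplit (k : ℕ) {n : ℕ} (C C' : Finset (Fin n)) (S : Finset (Fin n × Fin 2)) : Prop :=
  (Odd k ∧ (S ∩ clone1 C).card = (k-1)/2 ∧ (S ∩ clone2 C').card = (k-1)/2) ∨
  (Even k ∧ (((S ∩ clone1 C).card = k/2 ∧ (S ∩ clone2 C').card = (k-2)/2) ∨
    ((S ∩ clone1 C).card = (k-2)/2 ∧ (S ∩ clone2 C').card = k/2)))

theorem card_symmDiff_inter_add_s6 {α : Type*} [DecidableEq α] {S U P : Finset α} (hP : P ⊆ U) :
    (symmDiff S U ∩ P).card + (S ∩ P).card = P.card := by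
  have h : symmDiff S U ∩ P = P \ S := by
    ext e
    have := @hP e
    simp only [mem_inter, mem_symmDiff, mem_sdiff]
    tauto
  rw [h, inter_comm S P, add_comm, card_inter_add_card_sdiff]

theorem kikRel_iff {k n : ℕ} (hk : 2 ≤ k) {C C' : Finset (Fin n)} (hC : C.card = k - 1)
    (hC' : C'.card = k - 1) (S T : Finset (Fin n × Fin 2)) :
    KikRel k C C' S T ↔
      T = symmDiff S (clone1 C ∪ clone2 C') ∧ KikSplit k C C' S := by
  have hU : (clone1 C \ clone2 C') ∪ (clone2 C' \ clone1 C) = clone1 C ∪ clone2 C' := by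
    rw [(disjoint_clone1_clone2 C C').sdiff_eq_left, (disjoint_clone1_clone2 C C').sdiff_eq_right]
  have hT : (S \ T) ∪ (T \ S) = clone1 C ∪ clone2 C' ↔
      T = symmDiff S (clone1 C ∪ clone2 C') := by
    change symmDiff S T = _ ↔ _
    constructor
    · intro h
      rw [← h, symmDiff_symmDiff_cancel_left]
    · rintro rfl
      rw [symmDiff_symmDiff_cancel_left]
  rw [KikRel, KikSplit, hU, hT]
  refine and_congr_right ?_
  rintro rfl
  have h1 := card_symmDiff_inter_add_s6 (S := S)
    (subset_union_left : clone1 C ⊆ clone1 C ∪ clone2 C')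
  have h2 := card_symmDiff_inter_add_s6 (S := S)
    (subset_union_right : clone2 C' ⊆ clone1 C ∪ clone2 C')
  rw [card_clone1, hC] at h1
  rw [card_clone2, hC'] at h2
  refine or_congr (and_congr_right fun ⟨r, hr⟩ => ?_) (and_congr_right fun ⟨r, hr⟩ => ?_) <;>
    omega

theorem KikSplit.card_symmDiff {k n : ℕ} (hk : 2 ≤ k) {C C' : Finset (Fin n)}
    (hC : C.card = k - 1) (hC' : C'.card = k - 1) {S : Finset (Fin n × Fin 2)}
    (h : KikSplit k C C' S) : (symmDiff S (clone1 C ∪ clone2 C')).card = S.card := by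
  have hd := disjoint_clone1_clone2 C C'
  have hS : (S ∩ (clone1 C ∪ clone2 C')).card = k - 1 := by
    rw [inter_union_distrib_left,
      card_union_of_disjoint (hd.mono inter_subset_right inter_subset_right)]
    rcases h with ⟨⟨r, hr⟩, h⟩ | ⟨⟨r, hr⟩, h⟩ <;> omega
  have hU : (clone1 C ∪ clone2 C').card = (k - 1) + (k - 1) := by
    rw [card_union_of_disjoint hd, card_clone1, card_clone2, hC, hC']
  have h1 := card_inter_add_card_sdiff S (clone1 C ∪ clone2 C')
  have h2 := card_inter_add_card_sdiff (clone1 C ∪ clone2 C') S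
  rw [inter_comm] at h2
  change ((S \ _) ∪ (_ \ S)).card = _
  rw [card_union_of_disjoint disjoint_sdiff_sdiff]
  omega

theorem card_filter_kikSplit {k n ℓ : ℕ} (hk : 2 ≤ k) (hℓ : k - 1 ≤ ℓ)
    {C C' : Finset (Fin n)} (hC : C.card = k - 1) (hC' : C'.card = k - 1) :
    #{S ∈ ellSubsets n ℓ | KikSplit k C C' S} = kikD k n ℓ := by
  have key : ∀ a c : ℕ, a + c = k - 1 →
      #{S : Finset (Fin n × Fin 2) | S.card = ℓ ∧ (S ∩ clone1 C).card = a ∧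
          (S ∩ clone2 C').card = c}
        = (k-1).choose a * (k-1).choose c * (2*n - 2*(k-1)).choose (ℓ - (k-1)) := by
    intro a c hac
    have h := card_filter_card_inter_eq (disjoint_clone1_clone2 C C') a c (ℓ - (k-1))
    rw [hac, Nat.add_sub_cancel' hℓ, card_clone1, card_clone2, hC, hC', Fintype.card_prod,
      Fintype.card_fin, Fintype.card_fin, mul_comm n 2, ← two_mul] at h
    exact h
  rw [ellSubsets, filter_filter, kikD]
  split_ifs with hodd
  · rw [sq, ← key _ _ (by obtain ⟨r, hr⟩ := hodd; omega)]
    congr 1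
    ext S
    simp [KikSplit, hodd]
  · have heven : Even k := Nat.not_odd_iff_even.mp hodd
    have ⟨r, hr⟩ := heven
    have h1 := key (k/2) ((k-2)/2) (by omega)
    have h2 := key ((k-2)/2) (k/2) (by omega)
    rw [mul_comm (Nat.choose _ _)] at h2
    rw [mul_assoc 2, mul_assoc 2, two_mul]
    nth_rewrite 1 [← h1]
    rw [← h2, ← card_union_of_disjoint]
    · congr 1
      ext S
      simp only [KikSplit, hodd, heven, mem_filter, mem_union, mem_univ, true_and, false_and,
        false_or]
      tauto
    · rw [disjoint_left]
      intro S hS hS'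
      simp only [mem_filter, mem_univ, true_and] at hS hS'
      omega

theorem kikD_pos {k n ℓ : ℕ} (hk : 2 ≤ k) (hℓ : 2*(k-1) ≤ ℓ) (hℓn : ℓ ≤ n) :
    0 < kikD k n ℓ := by
  have h : 0 < (2*n - 2*(k-1)).choose (ℓ - (k-1)) := Nat.choose_pos (by omega)
  have h1 : 0 < (k-1).choose ((k-1)/2) := Nat.choose_pos (by omega)
  have h2 : 0 < (k-1).choose (k/2) := Nat.choose_pos (by omega)
  have h3 : 0 < (k-1).choose ((k-2)/2) := Nat.choose_pos (by omega)
  rw [kikD]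
  split_ifs <;> positivity

/-- A single pair of hyperedges contributes `D · x_C · x_{C'}` to the quadratic form. -/
theorem sum_kikRel {k n ℓ : ℕ} (hk : 2 ≤ k) (hℓ : k - 1 ≤ ℓ) {C C' : Finset (Fin n)}
    (hC : C.card = k - 1) (hC' : C'.card = k - 1) {x : Fin n → ℝ}
    (hx : ∀ i, x i = 1 ∨ x i = -1) :
    (∑ S ∈ ellSubsets n ℓ, ∑ T ∈ ellSubsets n ℓ,
        if KikRel k C C' S T then (∏ e ∈ S, x e.1) * ∏ e ∈ T, x e.1 else 0)
      = kikD k n ℓ * ((∏ i ∈ C, x i) * ∏ i ∈ C', x i) := by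
  have hd := disjoint_clone1_clone2 C C'
  have hrow : ∀ S ∈ ellSubsets n ℓ, (∑ T ∈ ellSubsets n ℓ,
      if KikRel k C C' S T then (∏ e ∈ S, x e.1) * ∏ e ∈ T, x e.1 else 0)
        = if KikSplit k C C' S then (∏ i ∈ C, x i) * ∏ i ∈ C', x i else 0 := by
    intro S hS
    simp only [kikRel_iff hk hC hC']
    split_ifs with h
    · simp only [h, and_true]
      rw [sum_ite_eq', if_pos, prod_mul_prod_eq_prod_symmDiff
        (y := fun e : Fin n × Fin 2 => x e.1) (fun e => hx e.1)]
      · change ∏ e ∈ symmDiff S (symmDiff S _), x e.1 = _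
        rw [symmDiff_symmDiff_cancel_left, prod_union hd, clone1, clone2,
          prod_image (Prod.mk_left_injective _).injOn, prod_image (Prod.mk_left_injective _).injOn]
      · simp only [ellSubsets, mem_filter, mem_univ, true_and] at hS ⊢
        rw [h.card_symmDiff hk hC hC', hS]
    · simp [h]
  rw [sum_congr rfl hrow, ← sum_filter, sum_const, card_filter_kikSplit hk hℓ hC hC', nsmul_eq_mul]

theorem kikA_quadratic_form {k n p m ℓ : ℕ} (hk : 2 ≤ k) (hℓ : k - 1 ≤ ℓ)
    (π : Fin m → Fin p) {Ed : Fin m → Finset (Fin n)} (hEd : ∀ j, (Ed j).card = k - 1)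
    (b : Fin m → ℝ) {x : Fin n → ℝ} (hx : ∀ i, x i = 1 ∨ x i = -1) :
    (∑ S ∈ ellSubsets n ℓ, ∑ T ∈ ellSubsets n ℓ,
        (∏ e ∈ S, x e.1) * kikA k n p m π Ed b S T * (∏ e ∈ T, x e.1))
      = kikD k n ℓ * ∑ j, ∑ j',
          if j ≠ j' ∧ π j = π j' then
            b j * b j' * (∏ i ∈ Ed j, x i) * (∏ i ∈ Ed j', x i)
          else 0 := by
  calc _ = ∑ S ∈ ellSubsets n ℓ, ∑ T ∈ ellSubsets n ℓ, ∑ j, ∑ j',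
        (if j ≠ j' ∧ π j = π j' then b j * b j' else 0) *
          if KikRel k (Ed j) (Ed j') S T then (∏ e ∈ S, x e.1) * ∏ e ∈ T, x e.1 else 0 := by
        refine sum_congr rfl fun S _ => sum_congr rfl fun T _ => ?_
        simp only [kikA, mul_sum, sum_mul]
        refine sum_congr rfl fun j _ => sum_congr rfl fun j' _ => ?_
        simp only [← and_assoc, ite_and _ (KikRel k (Ed j) (Ed j') S T)]
        split_ifs <;> ring
    _ = ∑ j, ∑ j', (if j ≠ j' ∧ π j = π j' then b j * b j' else 0) *
          ∑ S ∈ ellSubsets n ℓ, ∑ T ∈ ellSubsets n ℓ,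
            if KikRel k (Ed j) (Ed j') S T then (∏ e ∈ S, x e.1) * ∏ e ∈ T, x e.1 else 0 := by
        rw [sum_congr rfl fun S _ => sum_comm, sum_comm]
        refine sum_congr rfl fun j _ => ?_
        rw [sum_congr rfl fun S _ => sum_comm, sum_comm]
        simp only [mul_sum]
    _ = _ := by
        simp only [sum_kikRel hk hℓ (hEd _) (hEd _) hx, mul_sum]
        refine sum_congr rfl fun j _ => sum_congr rfl fun j' _ => ?_
        split_ifs <;> ring

theorem bddAbove_bilinear_signs {α : Type*} (s : Finset α) (M : α → α → ℝ) :
    BddAbove {r : ℝ | ∃ z w : α → ℝ,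
      (∀ S, z S = 1 ∨ z S = -1) ∧ (∀ S, w S = 1 ∨ w S = -1) ∧
      r = ∑ S ∈ s, ∑ T ∈ s, z S * M S T * w T} := by
  refine ⟨∑ S ∈ s, ∑ T ∈ s, |M S T|, ?_⟩
  rintro _ ⟨z, w, hz, hw, rfl⟩
  refine sum_le_sum fun S _ => sum_le_sum fun T _ => ?_
  have h1 := neg_abs_le (M S T)
  have h2 := le_abs_self (M S T)
  rcases hz S with h | h <;> rcases hw T with h' | h' <;> rw [h, h'] <;> linarith

/-- **quadratic form of the Kikuchi matrix.** With
`f(x) = (p/m²) Σ_{j≠j', π j = π j'} b_j b_{j'} x_{Ed j} x_{Ed j'}` and `A` the level-`ℓ`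
Kikuchi matrix: for every `x ∈ {−1,1}^n`, `(x^{⋆ℓ})ᵀ A x^{⋆ℓ} = (m²D/p)·f(x)`, and
consequently `max_x f(x) ≤ (p/(m²D))·‖A‖_{∞→1}` (the latter expressed via `sSup`). -/
theorem kikuchi_quadratic_form
    (k n p m ℓ : ℕ) (hk : 2 ≤ k) (hℓ : 2*(k-1) ≤ ℓ) (hℓn : ℓ ≤ n)
    (π : Fin m → Fin p) (Ed : Fin m → Finset (Fin n))
    (hEd : ∀ j, (Ed j).card = k - 1)
    (b : Fin m → ℝ) (hb : ∀ j, |b j| ≤ 1) :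
    (∀ x : Fin n → ℝ, (∀ i, x i = 1 ∨ x i = -1) →
      (∑ S ∈ ellSubsets n ℓ, ∑ T ∈ ellSubsets n ℓ,
          (∏ e ∈ S, x e.1) * kikA k n p m π Ed b S T * (∏ e ∈ T, x e.1))
        = ((m:ℝ)^2 * (kikD k n ℓ : ℝ) / (p:ℝ)) *
            (((p:ℝ)/(m:ℝ)^2) * ∑ j, ∑ j',
              if j ≠ j' ∧ π j = π j' then
                b j * b j' * (∏ i ∈ Ed j, x i) * (∏ i ∈ Ed j', x i)
              else 0)) ∧
    (∀ x : Fin n → ℝ, (∀ i, x i = 1 ∨ x i = -1) →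
      ((p:ℝ)/(m:ℝ)^2) * (∑ j, ∑ j',
          if j ≠ j' ∧ π j = π j' then
            b j * b j' * (∏ i ∈ Ed j, x i) * (∏ i ∈ Ed j', x i)
          else 0)
        ≤ ((p:ℝ)/((m:ℝ)^2 * (kikD k n ℓ : ℝ))) *
            sSup {r : ℝ | ∃ z w : Finset (Fin n × Fin 2) → ℝ,
              (∀ S, z S = 1 ∨ z S = -1) ∧ (∀ S, w S = 1 ∨ w S = -1) ∧
              r = ∑ S ∈ ellSubsets n ℓ, ∑ T ∈ ellSubsets n ℓ,
                    z S * kikA k n p m π Ed b S T * w T}) := by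
  have hD : (0 : ℝ) < kikD k n ℓ := by exact_mod_cast kikD_pos hk hℓ hℓn
  refine ⟨fun x hx => ?_, fun x hx => ?_⟩
  · rw [kikA_quadratic_form hk (by omega) π hEd b hx]
    rcases Nat.eq_zero_or_pos m with rfl | hm
    · simp
    have hp : (p : ℝ) ≠ 0 := Nat.cast_ne_zero.mpr (π ⟨0, hm⟩).pos.ne'
    have hm' : (m : ℝ) ≠ 0 := Nat.cast_ne_zero.mpr hm.ne'
    field_simp
  · have hle := le_csSup
      (bddAbove_bilinear_signs (ellSubsets n ℓ) (kikA k n p m π Ed b))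
      ⟨fun S => ∏ e ∈ S, x e.1, fun S => ∏ e ∈ S, x e.1,
        prod_eq_one_or_neg_one fun e => hx e.1, prod_eq_one_or_neg_one fun e => hx e.1, rfl⟩
    rw [kikA_quadratic_form hk (by omega) π hEd b hx] at hle
    refine le_trans (le_of_eq ?_) (mul_le_mul_of_nonneg_left hle (by positivity))
    rw [← mul_assoc, ← div_div, div_mul_cancel₀ _ hD.ne']
end

section
/- Let k ≥ 2, let H_u be a finite multiset of (k−1)-element subsets of [n], let b_{u,C} ∈ [−1,1] for C ∈ H_u, and let A_u be the corresponding Kikuchi matrix block at level ℓ. Then for every ℓ-element subset S of [n]×{1,2}, Σ_T |A_u(S,T)| ≤ γ_u(S), where the sum is over all ℓ-element subsets T of [n]×{1,2}. -/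
open Finset
open scoped Classical

/-- The Kikuchi matrix block `A_u` for a single `(k−1)`-uniform multiset `H_u`,
represented by the indexed family `Ed : Fin m → Finset (Fin n)` with coefficients `b`. -/
noncomputable def kikAu (k n m : ℕ) (Ed : Fin m → Finset (Fin n))
    (b : Fin m → ℝ) (S T : Finset (Fin n × Fin 2)) : ℝ :=
  ∑ j : Fin m, ∑ j' : Fin m,
    if j ≠ j' ∧ KikRel k (Ed j) (Ed j') S T then b j * b j' else 0

/-- The butterfly degree `γ_u(S)` of a set `S ⊆ [n] × {1,2}` with respect to the
`(k−1)`-uniform multiset represented by `Ed : Fin m → Finset (Fin n)`: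
`γ_u(S) = Σ_{(C,C') ordered distinct} Σ_{R ∈ R_{(C,C')}} 1(S ∩ (C^(1) ∪ C'^(2)) = R)`,
where `R_{(C,C')}` consists of the `(k−1)`-element subsets `R` of `[n] × {1,2}` with
`{|R ∩ C^(1)|, |R ∩ C'^(2)|} = {⌈(k−1)/2⌉, ⌊(k−1)/2⌋}`. -/
noncomputable def butterflyDeg (k n m : ℕ) (Ed : Fin m → Finset (Fin n))
    (S : Finset (Fin n × Fin 2)) : ℕ :=
  ∑ j : Fin m, ∑ j' : Fin m,
    if j ≠ j' then
      (Finset.univ.filter (fun R : Finset (Fin n × Fin 2) =>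
        R.card = k - 1 ∧
        (((R ∩ clone1 (Ed j)).card = k/2 ∧ (R ∩ clone2 (Ed j')).card = (k-1)/2) ∨
         ((R ∩ clone1 (Ed j)).card = (k-1)/2 ∧ (R ∩ clone2 (Ed j')).card = k/2)) ∧
        S ∩ (clone1 (Ed j) ∪ clone2 (Ed j')) = R)).card
    else 0

/-- The set `S` and the clones determine `T`. -/
theorem KikRel.right_unique {k n : ℕ} {C C' : Finset (Fin n)}
    {S T T' : Finset (Fin n × Fin 2)} (h : KikRel k C C' S T) (h' : KikRel k C C' S T') :
    T = T' :=
  (symmDiff_right_inj (a := S)).mp (h.1.trans h'.1.symm)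

/-- A nonzero entry in row `S` forces balanced intersections of `S` with the two clones. -/
theorem KikRel.card_inter {k n : ℕ} (hk : 2 ≤ k) {C C' : Finset (Fin n)}
    {S T : Finset (Fin n × Fin 2)} (h : KikRel k C C' S T) :
    ((S ∩ clone1 C).card = k/2 ∧ (S ∩ clone2 C').card = (k-1)/2) ∨
      ((S ∩ clone1 C).card = (k-1)/2 ∧ (S ∩ clone2 C').card = k/2) := by
  obtain ⟨-, ⟨⟨r, hr⟩, h⟩ | ⟨⟨r, hr⟩, h⟩⟩ := h <;> omega

/-- The part of `S` inside the two clones witnesses the butterfly degree. -/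
theorem KikRel.one_le_card_butterflies {k n : ℕ} (hk : 2 ≤ k) {C C' : Finset (Fin n)}
    {S T : Finset (Fin n × Fin 2)} (h : KikRel k C C' S T) :
    1 ≤ (Finset.univ.filter (fun R : Finset (Fin n × Fin 2) =>
        R.card = k - 1 ∧
        (((R ∩ clone1 C).card = k/2 ∧ (R ∩ clone2 C').card = (k-1)/2) ∨
         ((R ∩ clone1 C).card = (k-1)/2 ∧ (R ∩ clone2 C').card = k/2)) ∧
        S ∩ (clone1 C ∪ clone2 C') = R)).card := by
  have hc := h.card_inter hk
  rw [Nat.one_le_iff_ne_zero, ← Nat.pos_iff_ne_zero, Finset.card_pos]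
  refine ⟨S ∩ (clone1 C ∪ clone2 C'), ?_⟩
  rw [Finset.mem_filter]
  refine ⟨Finset.mem_univ _, ?_, ?_, rfl⟩
  · rw [Finset.inter_union_distrib_left, Finset.card_union_of_disjoint
      ((disjoint_clone1_clone2 C C').mono Finset.inter_subset_right Finset.inter_subset_right)]
    omega
  · rwa [Finset.inter_assoc, Finset.inter_assoc, Finset.union_inter_cancel_left,
      Finset.union_inter_cancel_right]

/-- Each entry of the block is bounded by the number of pairs contributing to it. -/
theorem abs_kikAu_le {k n m : ℕ} (Ed : Fin m → Finset (Fin n)) (b : Fin m → ℝ)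
    (hb : ∀ j, |b j| ≤ 1) (S T : Finset (Fin n × Fin 2)) :
    |kikAu k n m Ed b S T| ≤
      ∑ j : Fin m, ∑ j' : Fin m, if j ≠ j' ∧ KikRel k (Ed j) (Ed j') S T then (1 : ℝ) else 0 := by
  refine (Finset.abs_sum_le_sum_abs _ _).trans (Finset.sum_le_sum fun j _ => ?_)
  refine (Finset.abs_sum_le_sum_abs _ _).trans (Finset.sum_le_sum fun j' _ => ?_)
  split_ifs
  · rw [abs_mul]
    exact mul_le_one₀ (hb j) (abs_nonneg _) (hb j')
  · simp

/-- The `ℓ₁` norm of each row of the Kikuchi matrix block `A_u` is at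
most the butterfly degree: for every `ℓ`-element `S ⊆ [n] × {1,2}`,
`Σ_T |A_u(S,T)| ≤ γ_u(S)`, the sum ranging over all `ℓ`-element `T ⊆ [n] × {1,2}`. -/
theorem row_ell_one_le_butterfly_degree
    (k n m ℓ : ℕ) (hk : 2 ≤ k)
    (Ed : Fin m → Finset (Fin n)) (hEd : ∀ j, (Ed j).card = k - 1)
    (b : Fin m → ℝ) (hb : ∀ j, |b j| ≤ 1)
    (S : Finset (Fin n × Fin 2)) (hS : S.card = ℓ) :
    ∑ T ∈ ellSubsets n ℓ, |kikAu k n m Ed b S T| ≤ (butterflyDeg k n m Ed S : ℝ) := by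
  refine (Finset.sum_le_sum fun T _ => abs_kikAu_le Ed b hb S T).trans ?_
  rw [Finset.sum_comm, butterflyDeg, Nat.cast_sum]
  refine Finset.sum_le_sum fun j _ => ?_
  rw [Finset.sum_comm, Nat.cast_sum]
  refine Finset.sum_le_sum fun j' _ => ?_
  rw [Finset.sum_boole, Nat.cast_le]
  split_ifs with hj
  · obtain h | ⟨T, hT⟩ := Finset.eq_empty_or_nonempty
      ((ellSubsets n ℓ).filter fun T => j ≠ j' ∧ KikRel k (Ed j) (Ed j') S T)
    · rw [h, Finset.card_empty]
      exact Nat.zero_le _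
    · refine le_trans (Finset.card_le_one.mpr fun T hT T' hT' => ?_)
        ((Finset.mem_filter.mp hT).2.2.one_le_card_butterflies hk)
      exact (Finset.mem_filter.mp hT).2.2.right_unique (Finset.mem_filter.mp hT').2.2
  · simp [hj]
end
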